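/- In the random-design regression model, assume max_{j=1,…,M} ‖φ_j‖_{P_X,∞} ≤ L_φ for some L_φ > 0 and that the errors satisfy: there exist b, σ² > 0 such that E(e^{tξ₁} | X₁) ≤ e^{σ²t²/2} P_X-almost surely for all |t| ≤ b. Then for every β ≥ max( 2σ² + 2·sup_{λ∈Λ} ‖f_λ − f‖²_{P_X,∞}, 4RL_φ/b ), the mirror averaging aggregate f̂_n with the sparsity prior (parameters M ≥ 2, τ > 0, R > 2Mτ) satisfies: E_f[‖f̂_n − f‖²_{P_X,2}] ≤ inf over λ* with ‖λ*‖₁ ≤ R − 2Mτ of { ‖f_{λ*} − f‖²_{P_X,2} + (4β/(n+1)) ∑_{j=1}^M log(1 + τ⁻¹|λ*_j|) } + 4τ²M + β/(n+1). -/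

import Mathlib

open MeasureTheory

theorem exp_quadratic_le_tangent {s D β u v : ℝ} (hs : 0 ≤ s) (hD : 0 ≤ D) (hβ0 : 0 < β)
    (hβ : 2 * s + 2 * D ≤ β) (hu : u ^ 2 ≤ D) (hv : v ^ 2 ≤ D) :
    Real.exp (s * (2 * (u - v) / β) ^ 2 / 2 + (v ^ 2 - u ^ 2) / β) ≤
      1 - 2 * v / β * (u - v) := by
  set Ψ : ℝ → ℝ := fun x => s * (2 * (x - v) / β) ^ 2 / 2 + (v ^ 2 - x ^ 2) / β with hΨ
  set Ψ' : ℝ → ℝ := fun x => 4 * s * (x - v) / β ^ 2 - 2 * x / β with hΨ'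
  have h1 : ∀ x, HasDerivAt Ψ (Ψ' x) x := by
    intro x
    have := (((((((hasDerivAt_id x).sub_const v).const_mul 2).div_const β).pow 2).const_mul
      s).div_const 2).add (((hasDerivAt_const x (v ^ 2)).sub
        ((hasDerivAt_id x).pow 2)).div_const β)
    convert! this using 1
    simp only [hΨ', id, Nat.cast_ofNat, Nat.add_one_sub_one, pow_one]
    ring
  have h2 : ∀ x, HasDerivAt Ψ' (4 * s / β ^ 2 - 2 / β) x := by
    intro x
    have := ((((hasDerivAt_id x).sub_const v).const_mul (4 * s)).div_const (β ^ 2)).sub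
      (((hasDerivAt_id x).const_mul 2).div_const β)
    convert! this using 1
    simp
  have hmem : ∀ x : ℝ, x ∈ Set.Icc (-√D) (√D) ↔ x ^ 2 ≤ D := by
    intro x
    rw [Set.mem_Icc, ← abs_le, Real.le_sqrt (abs_nonneg x) hD, sq_abs]
  have hconc : ConcaveOn ℝ (Set.Icc (-√D) (√D)) (fun x => Real.exp (Ψ x)) := by
    refine concaveOn_of_hasDerivWithinAt2_nonpos (convex_Icc _ _)
      (f' := fun x => Real.exp (Ψ x) * Ψ' x)
      (f'' := fun x => Real.exp (Ψ x) * Ψ' x * Ψ' x +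
        Real.exp (Ψ x) * (4 * s / β ^ 2 - 2 / β)) ?_ ?_ ?_ ?_
    · exact fun x _ => (h1 x).exp.continuousAt.continuousWithinAt
    · exact fun x _ => (h1 x).exp.hasDerivWithinAt
    · exact fun x _ => ((h1 x).exp.mul (h2 x)).hasDerivWithinAt
    · intro x hx
      have hx2 := (hmem x).1 (interior_subset hx)
      have hconv : ((1 - 2 * s / β) * x + 2 * s / β * v) ^ 2 ≤ D := by
        have h0 : 0 ≤ 2 * s / β := by positivity
        have h1 : 0 ≤ 1 - 2 * s / β := by
          rw [sub_nonneg, div_le_one hβ0]; linarith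
        nlinarith [mul_nonneg h0 (mul_nonneg h1 (sq_nonneg (x - v))),
          mul_le_mul_of_nonneg_left hx2 h1, mul_le_mul_of_nonneg_left hv h0]
      have e1 : Ψ' x * Ψ' x = 4 / β ^ 2 * ((1 - 2 * s / β) * x + 2 * s / β * v) ^ 2 := by
        simp only [hΨ']; field_simp; ring
      have e2 : 4 / β ^ 2 * D + (4 * s / β ^ 2 - 2 / β) = 2 / β ^ 2 * (2 * s + 2 * D - β) := by
        field_simp; ring
      have e3 : 2 / β ^ 2 * (2 * s + 2 * D - β) ≤ 0 :=
        mul_nonpos_of_nonneg_of_nonpos (by positivity) (by linarith)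
      have e4 : 4 / β ^ 2 * ((1 - 2 * s / β) * x + 2 * s / β * v) ^ 2 ≤ 4 / β ^ 2 * D :=
        mul_le_mul_of_nonneg_left hconv (by positivity)
      rw [mul_assoc, ← mul_add]
      exact mul_nonpos_of_nonneg_of_nonpos (Real.exp_pos _).le (by linarith)
  have hΨv : Ψ v = 0 := by simp [hΨ]
  have hd : HasDerivAt (fun x => Real.exp (Ψ x)) (-(2 * v / β)) v := by
    convert! (h1 v).exp using 1
    simp [hΨv, hΨ']
  change Real.exp (Ψ u) ≤ _
  rcases lt_trichotomy u v with h | h | h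
  · have := hconc.le_slope_of_hasDerivAt ((hmem u).2 hu) ((hmem v).2 hv) h hd
    rw [slope_def_field, hΨv, Real.exp_zero, le_div_iff₀ (by linarith)] at this
    linarith
  · simp [h, hΨv]
  · have := hconc.slope_le_of_hasDerivAt ((hmem v).2 hv) ((hmem u).2 hu) h hd
    rw [slope_def_field, hΨv, Real.exp_zero, div_le_iff₀ (by linarith)] at this
    linarith

section Regression

variable {X : Type*} [MeasurableSpace X] {P : Measure (X × ℝ)} [IsProbabilityMeasure P]
  {f : X → ℝ} {b s : ℝ}

theorem ae_lintegral_exp_condKernel_le (hf : Measurable f) (hb : 0 < b)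
    (hexpint : ∀ t : ℝ, |t| ≤ b →
      Integrable (fun z : X × ℝ => Real.exp (t * (z.2 - f z.1))) P)
    (hsubg : ∀ t : ℝ, |t| ≤ b → ∀ A : Set X, MeasurableSet A →
      (∫ z in {z : X × ℝ | z.1 ∈ A}, Real.exp (t * (z.2 - f z.1)) ∂P) ≤
        Real.exp (s * t ^ 2 / 2) * (P.fst A).toReal) :
    ∀ᵐ x ∂P.fst, ∀ t : ℝ, |t| ≤ b →
      ∫⁻ y, ENNReal.ofReal (Real.exp (t * (y - f x))) ∂P.condKernel x ≤
        ENNReal.ofReal (Real.exp (s * t ^ 2 / 2)) := by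
  have hmeas : ∀ t : ℝ, Measurable
      (fun z : X × ℝ => ENNReal.ofReal (Real.exp (t * (z.2 - f z.1)))) := by
    intro t; fun_prop
  have hfix : ∀ t : ℝ, |t| ≤ b → ∀ᵐ x ∂P.fst,
      ∫⁻ y, ENNReal.ofReal (Real.exp (t * (y - f x))) ∂P.condKernel x ≤
        ENNReal.ofReal (Real.exp (s * t ^ 2 / 2)) := by
    intro t ht
    refine ae_le_of_forall_setLIntegral_le_of_sigmaFinite
      (Measurable.lintegral_kernel_prod_right' (hmeas t)) fun A hA _ => ?_
    rw [Measure.setLIntegral_condKernel_univ_right (hmeas t) hA, setLIntegral_const]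
    have hset : A ×ˢ (Set.univ : Set ℝ) = {z : X × ℝ | z.1 ∈ A} := by ext; simp
    rw [hset, ← ofReal_integral_eq_lintegral_ofReal (hexpint t ht).restrict
      (.of_forall fun _ => (Real.exp_pos _).le)]
    refine (ENNReal.ofReal_le_ofReal (hsubg t ht A hA)).trans_eq ?_
    rw [ENNReal.ofReal_mul (Real.exp_pos _).le, ENNReal.ofReal_toReal (measure_ne_top _ _)]
  have hrat : ∀ᵐ x ∂P.fst, ∀ q : ℚ, |(q : ℝ)| ≤ b →
      ∫⁻ y, ENNReal.ofReal (Real.exp (q * (y - f x))) ∂P.condKernel x ≤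
        ENNReal.ofReal (Real.exp (s * (q : ℝ) ^ 2 / 2)) := by
    rw [ae_all_iff]
    intro q
    by_cases hq : |(q : ℝ)| ≤ b
    · filter_upwards [hfix q hq] with x hx _ using hx
    · exact .of_forall fun x h => absurd h hq
  filter_upwards [hrat] with x hx t ht
  obtain ⟨q, hqb, hqt⟩ : ∃ q : ℕ → ℚ, (∀ k, |(q k : ℝ)| ≤ b) ∧
      Filter.Tendsto (fun k => (q k : ℝ)) Filter.atTop (nhds t) := by
    have hcl : t ∈ closure (Set.Icc (-b) b ∩ Set.range ((↑) : ℚ → ℝ)) := by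
      have : t ∈ closure (Set.Ioo (-b) b ∩ Set.range ((↑) : ℚ → ℝ)) := by
        refine closure_minimal (Rat.isDenseEmbedding_coe_real.dense.open_subset_closure_inter
          isOpen_Ioo) isClosed_closure ?_
        rw [closure_Ioo (by linarith)]
        exact abs_le.1 ht
      exact closure_mono (Set.inter_subset_inter_left _ Set.Ioo_subset_Icc_self) this
    obtain ⟨a, ha, hat⟩ := mem_closure_iff_seq_limit.1 hcl
    choose q hq using fun k => (ha k).2
    refine ⟨q, fun k => ?_, ?_⟩
    · rw [hq k]; exact abs_le.2 (ha k).1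
    · simpa only [hq] using hat
  calc ∫⁻ y, ENNReal.ofReal (Real.exp (t * (y - f x))) ∂P.condKernel x
      = ∫⁻ y, Filter.liminf (fun k => ENNReal.ofReal (Real.exp (q k * (y - f x))))
          Filter.atTop ∂P.condKernel x := by
        refine lintegral_congr fun y => (Filter.Tendsto.liminf_eq ?_).symm
        exact ENNReal.tendsto_ofReal ((Real.continuous_exp.tendsto _).comp (hqt.mul_const _))
    _ ≤ Filter.liminf (fun k => ∫⁻ y, ENNReal.ofReal (Real.exp (q k * (y - f x)))
          ∂P.condKernel x) Filter.atTop := lintegral_liminf_le fun k => by fun_prop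
    _ ≤ Filter.liminf (fun k => ENNReal.ofReal (Real.exp (s * (q k : ℝ) ^ 2 / 2)))
          Filter.atTop := Filter.liminf_le_liminf (.of_forall fun k => hx (q k) (hqb k))
    _ = ENNReal.ofReal (Real.exp (s * t ^ 2 / 2)) := by
        refine Filter.Tendsto.liminf_eq (ENNReal.tendsto_ofReal
          ((Real.continuous_exp.tendsto _).comp ?_))
        exact ((hqt.pow 2).const_mul s).div_const 2

theorem ae_integral_sub_condKernel_eq_zero
    (hξ : Integrable (fun z : X × ℝ => z.2 - f z.1) P)
    (hreg : ∀ A : Set X, MeasurableSet A →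
      (∫ z in {z : X × ℝ | z.1 ∈ A}, (z.2 - f z.1) ∂P) = 0) :
    ∀ᵐ x ∂P.fst, ∫ y, (y - f x) ∂P.condKernel x = 0 := by
  refine Integrable.ae_eq_zero_of_forall_setIntegral_eq_zero hξ.integral_condKernel ?_
  intro A hA _
  have hset : A ×ˢ (Set.univ : Set ℝ) = {z : X × ℝ | z.1 ∈ A} := by ext; simp
  have := Measure.setIntegral_condKernel_univ_right (ρ := P) hA hξ.integrableOn
  rw [this, hset, hreg A hA]

theorem integral_sq_sub_eq_add (hf : Measurable f)
    (hξ2 : Integrable (fun z : X × ℝ => (z.2 - f z.1) ^ 2) P)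
    (hreg : ∀ A : Set X, MeasurableSet A →
      (∫ z in {z : X × ℝ | z.1 ∈ A}, (z.2 - f z.1) ∂P) = 0)
    {g : X → ℝ} (hg : Measurable g) {D : ℝ} (hgD : ∀ᵐ x ∂P.fst, (g x - f x) ^ 2 ≤ D) :
    Integrable (fun z : X × ℝ => (z.2 - g z.1) ^ 2) P ∧
    ∫ z, (z.2 - g z.1) ^ 2 ∂P =
      ∫ z, (z.2 - f z.1) ^ 2 ∂P + ∫ x, (g x - f x) ^ 2 ∂P.fst := by
  have hξL2 : MemLp (fun z : X × ℝ => z.2 - f z.1) 2 P :=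
    (memLp_two_iff_integrable_sq (by fun_prop)).2 hξ2
  have hξ : Integrable (fun z : X × ℝ => z.2 - f z.1) P := hξL2.integrable (by norm_num)
  have hgint : Integrable (fun x => (g x - f x) ^ 2) P.fst := by
    refine Integrable.of_bound (by fun_prop) D ?_
    filter_upwards [hgD] with x hx
    rwa [Real.norm_of_nonneg (sq_nonneg _)]
  have hgint' : Integrable (fun z : X × ℝ => (g z.1 - f z.1) ^ 2) P :=
    Integrable.comp_measurable (g := fun x => (g x - f x) ^ 2) hgint measurable_fst
  have hgL2 : MemLp (fun z : X × ℝ => g z.1 - f z.1) 2 P :=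
    (memLp_two_iff_integrable_sq (by fun_prop)).2 hgint'
  have hcross : Integrable (fun z : X × ℝ => (g z.1 - f z.1) * (z.2 - f z.1)) P :=
    hgL2.integrable_mul hξL2
  have hcross0 : ∫ z, (g z.1 - f z.1) * (z.2 - f z.1) ∂P = 0 := by
    rw [← Measure.integral_condKernel hcross]
    refine integral_eq_zero_of_ae ?_
    filter_upwards [ae_integral_sub_condKernel_eq_zero hξ hreg] with x hx
    simp only [integral_const_mul, hx, mul_zero, Pi.zero_apply]
  have hexpand : (fun z : X × ℝ => (z.2 - g z.1) ^ 2) = fun z =>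
      (z.2 - f z.1) ^ 2 + (g z.1 - f z.1) ^ 2 - 2 * ((g z.1 - f z.1) * (z.2 - f z.1)) := by
    ext z; ring
  have hfst : ∫ z, (g z.1 - f z.1) ^ 2 ∂P = ∫ x, (g x - f x) ^ 2 ∂P.fst :=
    (integral_map (f := fun x => (g x - f x) ^ 2) measurable_fst.aemeasurable
      (by fun_prop)).symm
  rw [hexpand]
  refine ⟨(hξ2.add hgint').sub (hcross.const_mul 2), ?_⟩
  rw [integral_sub, integral_add hξ2 hgint',
    integral_const_mul, hcross0, hfst]
  · ring
  · exact hξ2.add hgint'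
  · exact hcross.const_mul 2
end Regression

theorem abs_log_integral_exp_le {E : Type*} [MeasurableSpace E] {ρ : Measure E}
    [IsProbabilityMeasure ρ] {u : E → ℝ} {C : ℝ} (hu : Measurable u)
    (hu0 : ∀ᵐ l ∂ρ, u l ≤ 0) (huC : ∀ᵐ l ∂ρ, -C ≤ u l) :
    |Real.log (∫ l, Real.exp (u l) ∂ρ)| ≤ C := by
  have hint : Integrable (fun l => Real.exp (u l)) ρ := by
    refine Integrable.of_bound (by fun_prop) 1 ?_
    filter_upwards [hu0] with l hl
    rw [Real.norm_of_nonneg (Real.exp_pos _).le]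
    exact Real.exp_le_one_iff.2 hl
  have hlow : Real.exp (-C) ≤ ∫ l, Real.exp (u l) ∂ρ := by
    have : ∫ _, Real.exp (-C) ∂ρ ≤ ∫ l, Real.exp (u l) ∂ρ := by
      refine integral_mono_ae (integrable_const _) hint ?_
      filter_upwards [huC] with l hl using Real.exp_le_exp.2 hl
    simpa using this
  have hup : ∫ l, Real.exp (u l) ∂ρ ≤ 1 := by
    have : ∫ l, Real.exp (u l) ∂ρ ≤ ∫ _, (1 : ℝ) ∂ρ := by
      refine integral_mono_ae hint (integrable_const _) ?_
      filter_upwards [hu0] with l hl using Real.exp_le_one_iff.2 hl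
    simpa using this
  have hpos := (Real.exp_pos (-C)).trans_le hlow
  have h1 := Real.log_nonpos hpos.le hup
  have h2 := (Real.le_log_iff_exp_le hpos).2 hlow
  rw [abs_le]
  constructor <;> linarith

theorem sq_integral_sub_le {E : Type*} [MeasurableSpace E] {ρ : Measure E}
    [IsProbabilityMeasure ρ] {g : E → ℝ} {a D : ℝ} (hg : Integrable g ρ) (hD : 0 ≤ D)
    (h : ∀ᵐ l ∂ρ, (g l - a) ^ 2 ≤ D) : (∫ l, g l ∂ρ - a) ^ 2 ≤ D := by
  have h1 : ∫ l, g l ∂ρ - a = ∫ l, (g l - a) ∂ρ := by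
    rw [integral_sub hg (integrable_const _)]; simp
  have h2 : ‖∫ l, (g l - a) ∂ρ‖ ≤ √D * ρ.real Set.univ := by
    refine norm_integral_le_of_norm_le_const ?_
    filter_upwards [h] with l hl
    exact Real.abs_le_sqrt hl
  rw [h1]
  simp only [probReal_univ, mul_one, Real.norm_eq_abs] at h2
  rw [← sq_abs]
  exact (Real.le_sqrt (abs_nonneg _) hD).1 h2

section OneStep

variable {X E : Type*} [MeasurableSpace X] [MeasurableSpace E]
  {P : Measure (X × ℝ)} [IsProbabilityMeasure P] {ρ : Measure E} [IsProbabilityMeasure ρ]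
  {f : X → ℝ} {F : E → X → ℝ} {b s B D β : ℝ}

theorem lintegral_exp_tilt_le_one
    (hmgf : ∀ᵐ x ∂P.fst, ∀ t : ℝ, |t| ≤ b →
      ∫⁻ y, ENNReal.ofReal (Real.exp (t * (y - f x))) ∂P.condKernel x ≤
        ENNReal.ofReal (Real.exp (s * t ^ 2 / 2)))
    (hF : Measurable (Function.uncurry F))
    (hFB : ∀ᵐ x ∂P.fst, ∀ᵐ l ∂ρ, |F l x| ≤ B ∧ (F l x - f x) ^ 2 ≤ D)
    (hs : 0 ≤ s) (hD : 0 ≤ D) (hβ0 : 0 < β) (hβ : 2 * s + 2 * D ≤ β) (hβb : 4 * B ≤ b * β) :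
    ∫⁻ z, ∫⁻ l, ENNReal.ofReal (Real.exp
      (((z.2 - ∫ w, F w z.1 ∂ρ) ^ 2 - (z.2 - F l z.1) ^ 2) / β)) ∂ρ ∂P ≤ 1 := by
  have hFx : ∀ x, Measurable fun l => F l x := fun x =>
    hF.comp (measurable_id.prodMk measurable_const)
  have hm : Measurable fun x => ∫ w, F w x ∂ρ := by
    have : StronglyMeasurable (Function.uncurry fun (x : X) (w : E) => F w x) :=
      (hF.comp measurable_swap).stronglyMeasurable
    exact (this.integral_prod_right (ν := ρ)).measurable
  have hmeas : Measurable fun q : (X × ℝ) × E => ENNReal.ofReal (Real.exp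
      (((q.1.2 - ∫ w, F w q.1.1 ∂ρ) ^ 2 - (q.1.2 - F q.2 q.1.1) ^ 2) / β)) := by
    have h1 : Measurable fun q : (X × ℝ) × E => ∫ w, F w q.1.1 ∂ρ :=
      hm.comp (measurable_fst.comp measurable_fst)
    have h2 : Measurable fun q : (X × ℝ) × E => F q.2 q.1.1 :=
      hF.comp (measurable_snd.prodMk (measurable_fst.comp measurable_fst))
    fun_prop
  rw [← Measure.lintegral_condKernel (ρ := P) hmeas.lintegral_prod_right']
  have hbound : ∀ᵐ x ∂P.fst, ∫⁻ y, ∫⁻ l, ENNReal.ofReal (Real.exp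
      (((y - ∫ w, F w x ∂ρ) ^ 2 - (y - F l x) ^ 2) / β)) ∂ρ ∂P.condKernel x ≤ 1 := by
    filter_upwards [hmgf, hFB] with x hx hxB
    set m := ∫ w, F w x ∂ρ with hmdef
    have hFint : Integrable (fun l => F l x) ρ :=
      Integrable.of_bound (hFx x).aestronglyMeasurable B (hxB.mono fun l hl => hl.1)
    have hmB : |m| ≤ B := by
      have := norm_integral_le_of_norm_le_const
        (hxB.mono fun l hl => (Real.norm_eq_abs _).trans_le hl.1)
      simpa using this
    have hmD : (m - f x) ^ 2 ≤ D := sq_integral_sub_le hFint hD (hxB.mono fun l hl => hl.2)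
    rw [lintegral_lintegral_swap]
    · calc ∫⁻ l, ∫⁻ y, ENNReal.ofReal (Real.exp (((y - m) ^ 2 - (y - F l x) ^ 2) / β))
            ∂P.condKernel x ∂ρ
          ≤ ∫⁻ l, ENNReal.ofReal (1 - 2 * (m - f x) / β * (F l x - m)) ∂ρ := by
            refine lintegral_mono_ae ?_
            filter_upwards [hxB] with l hl
            have ht : |2 * (F l x - m) / β| ≤ b := by
              rw [abs_div, abs_of_pos hβ0, div_le_iff₀ hβ0, abs_mul, abs_two]
              have := abs_sub (F l x) m
              linarith [hl.1]
            have hsplit : ∀ y, ENNReal.ofReal (Real.exp (((y - m) ^ 2 - (y - F l x) ^ 2) / β)) =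
                ENNReal.ofReal (Real.exp (((m - f x) ^ 2 - (F l x - f x) ^ 2) / β)) *
                ENNReal.ofReal (Real.exp (2 * (F l x - m) / β * (y - f x))) := by
              intro y
              rw [← ENNReal.ofReal_mul (Real.exp_pos _).le, ← Real.exp_add]
              congr 2
              field_simp
              ring
            simp_rw [hsplit]
            rw [lintegral_const_mul _ (by fun_prop)]
            refine (mul_le_mul_right (hx _ ht) _).trans ?_
            rw [← ENNReal.ofReal_mul (Real.exp_pos _).le, ← Real.exp_add]
            refine ENNReal.ofReal_le_ofReal ?_
            have := exp_quadratic_le_tangent hs hD hβ0 hβ hl.2 hmD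
            simp only [sub_sub_sub_cancel_right] at this
            rwa [add_comm]
        _ = ENNReal.ofReal (∫ l, (1 - 2 * (m - f x) / β * (F l x - m)) ∂ρ) := by
            refine (ofReal_integral_eq_lintegral_ofReal ?_ ?_).symm
            · exact (integrable_const _).sub ((hFint.sub (integrable_const _)).const_mul _)
            · filter_upwards [hxB] with l hl
              have := exp_quadratic_le_tangent hs hD hβ0 hβ hl.2 hmD
              simp only [sub_sub_sub_cancel_right] at this
              exact (Real.exp_pos _).le.trans this
        _ ≤ 1 := by
            have hsub : Integrable (fun l => F l x - m) ρ := hFint.sub (integrable_const _)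
            rw [integral_sub (integrable_const _) (hsub.const_mul _), integral_const_mul,
              integral_sub hFint (integrable_const _), ← hmdef]
            simp
    · refine Measurable.aemeasurable ?_
      have h2 : Measurable fun q : ℝ × E => F q.2 x := (hFx x).comp measurable_snd
      simp only [Function.uncurry_def]
      fun_prop
  calc _ ≤ ∫⁻ _, 1 ∂P.fst := lintegral_mono_ae hbound
    _ = 1 := by simp

theorem integral_sq_sub_integral_le (hf : Measurable f)
    (hξ2 : Integrable (fun z : X × ℝ => (z.2 - f z.1) ^ 2) P)
    (hreg : ∀ A : Set X, MeasurableSet A →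
      (∫ z in {z : X × ℝ | z.1 ∈ A}, (z.2 - f z.1) ∂P) = 0)
    (hmgf : ∀ᵐ x ∂P.fst, ∀ t : ℝ, |t| ≤ b →
      ∫⁻ y, ENNReal.ofReal (Real.exp (t * (y - f x))) ∂P.condKernel x ≤
        ENNReal.ofReal (Real.exp (s * t ^ 2 / 2)))
    (hF : Measurable (Function.uncurry F))
    (hFB : ∀ᵐ x ∂P.fst, ∀ᵐ l ∂ρ, |F l x| ≤ B ∧ (F l x - f x) ^ 2 ≤ D)
    (hs : 0 ≤ s) (hD : 0 ≤ D) (hβ0 : 0 < β) (hβ : 2 * s + 2 * D ≤ β) (hβb : 4 * B ≤ b * β) :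
    ∫ z, (z.2 - f z.1) ^ 2 ∂P + ∫ x, (∫ l, F l x ∂ρ - f x) ^ 2 ∂P.fst ≤
      -β * ∫ z, Real.log (∫ l, Real.exp (-(z.2 - F l z.1) ^ 2 / β) ∂ρ) ∂P := by
  have hFx : ∀ x, Measurable fun l => F l x := fun x =>
    hF.comp (measurable_id.prodMk measurable_const)
  have hm : Measurable fun x => ∫ w, F w x ∂ρ := by
    have : StronglyMeasurable (Function.uncurry fun (x : X) (w : E) => F w x) :=
      (hF.comp measurable_swap).stronglyMeasurable
    exact (this.integral_prod_right (ν := ρ)).measurable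
  have hmD : ∀ᵐ x ∂P.fst, (∫ l, F l x ∂ρ - f x) ^ 2 ≤ D := by
    filter_upwards [hFB] with x hx
    exact sq_integral_sub_le (Integrable.of_bound (hFx x).aestronglyMeasurable B
      (hx.mono fun l hl => hl.1)) hD (hx.mono fun l hl => hl.2)
  obtain ⟨hQint, hQ⟩ := integral_sq_sub_eq_add hf hξ2 hreg hm hmD
  have hF3 : Measurable fun q : (X × ℝ) × E => F q.2 q.1.1 :=
    hF.comp (measurable_snd.prodMk (measurable_fst.comp measurable_fst))
  have hmeasH : Measurable fun z : X × ℝ => ∫⁻ l, ENNReal.ofReal (Real.exp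
      (((z.2 - ∫ w, F w z.1 ∂ρ) ^ 2 - (z.2 - F l z.1) ^ 2) / β)) ∂ρ := by
    have h1 : Measurable fun q : (X × ℝ) × E => ∫ w, F w q.1.1 ∂ρ :=
      hm.comp (measurable_fst.comp measurable_fst)
    have : Measurable fun q : (X × ℝ) × E => ENNReal.ofReal (Real.exp
        (((q.1.2 - ∫ w, F w q.1.1 ∂ρ) ^ 2 - (q.1.2 - F q.2 q.1.1) ^ 2) / β)) := by fun_prop
    exact this.lintegral_prod_right'
  have hHle := lintegral_exp_tilt_le_one hmgf hF hFB hs hD hβ0 hβ hβb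
  set H : X × ℝ → ℝ := fun z => (∫⁻ l, ENNReal.ofReal (Real.exp
      (((z.2 - ∫ w, F w z.1 ∂ρ) ^ 2 - (z.2 - F l z.1) ^ 2) / β)) ∂ρ).toReal with hH
  have hHint : Integrable H P := integrable_toReal_of_lintegral_ne_top hmeasH.aemeasurable
    (ne_top_of_le_ne_top ENNReal.one_ne_top hHle)
  have hH1 : ∫ z, H z ∂P ≤ 1 := by
    rw [hH, integral_toReal hmeasH.aemeasurable (ae_lt_top hmeasH
      (ne_top_of_le_ne_top ENNReal.one_ne_top hHle))]
    exact ENNReal.toReal_mono ENNReal.one_ne_top hHle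
  set G : X × ℝ → ℝ := fun z => Real.log (∫ l, Real.exp (-(z.2 - F l z.1) ^ 2 / β) ∂ρ) with hG
  have hGle : ∀ z, G z ≤ -(z.2 - ∫ w, F w z.1 ∂ρ) ^ 2 / β + (H z - 1) := by
    intro z
    have hFz := hFx z.1
    have hexp : Integrable (fun l => Real.exp (-(z.2 - F l z.1) ^ 2 / β)) ρ := by
      refine Integrable.of_bound (by fun_prop) 1 (.of_forall fun l => ?_)
      rw [Real.norm_of_nonneg (Real.exp_pos _).le, Real.exp_le_one_iff, neg_div, neg_nonpos]
      positivity
    have hpos := integral_exp_pos hexp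
    have hfac : ∫ l, Real.exp (-(z.2 - F l z.1) ^ 2 / β) ∂ρ =
        Real.exp (-(z.2 - ∫ w, F w z.1 ∂ρ) ^ 2 / β) * H z := by
      simp only [hH]
      rw [← integral_eq_lintegral_of_nonneg_ae (.of_forall fun l => (Real.exp_pos _).le)
        (by fun_prop), ← integral_const_mul]
      refine integral_congr_ae (.of_forall fun l => ?_)
      simp only
      rw [← Real.exp_add]
      congr 1
      ring
    have hHpos : 0 < H z := by
      rw [hfac] at hpos
      exact (mul_pos_iff_of_pos_left (Real.exp_pos _)).1 hpos
    simp only [hG]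
    rw [hfac, Real.log_mul (Real.exp_pos _).ne' hHpos.ne', Real.log_exp]
    linarith [Real.log_le_sub_one_of_pos hHpos]
  have hGint : Integrable G P := by
    have hGmeas : Measurable G := by
      have : StronglyMeasurable fun q : (X × ℝ) × E => Real.exp (-(q.1.2 - F q.2 q.1.1) ^ 2 / β) :=
        Measurable.stronglyMeasurable (by fun_prop)
      exact (this.integral_prod_right' (ν := ρ)).measurable.log
    have hdom : Integrable (fun z : X × ℝ => (2 * (z.2 - f z.1) ^ 2 + 2 * D) / β) P :=
      ((hξ2.const_mul 2).add (integrable_const _)).div_const β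
    refine hdom.mono' hGmeas.aestronglyMeasurable ?_
    have hFB' := ae_of_ae_map (f := Prod.fst) measurable_fst.aemeasurable hFB
    filter_upwards [hFB'] with z hz
    have hFz := hFx z.1
    refine abs_log_integral_exp_le (by fun_prop) (.of_forall fun l => ?_) ?_
    · rw [neg_div, neg_nonpos]; positivity
    · filter_upwards [hz] with l hl
      rw [← neg_div]
      refine div_le_div_of_nonneg_right ?_ hβ0.le
      nlinarith [hl.2, sq_nonneg ((z.2 - f z.1) + (F l z.1 - f z.1))]
  have hfinal : ∫ z, G z ∂P ≤ -(∫ z, (z.2 - ∫ w, F w z.1 ∂ρ) ^ 2 ∂P) / β + (∫ z, H z ∂P - 1) := by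
    have hQ' : Integrable (fun z : X × ℝ => -(z.2 - ∫ w, F w z.1 ∂ρ) ^ 2 / β) P :=
      hQint.neg.div_const β
    have hH' : Integrable (fun z => H z - 1) P := hHint.sub (integrable_const _)
    calc ∫ z, G z ∂P ≤ ∫ z, (-(z.2 - ∫ w, F w z.1 ∂ρ) ^ 2 / β + (H z - 1)) ∂P :=
          integral_mono hGint (hQ'.add hH') hGle
      _ = _ := by
          rw [integral_add hQ' hH', integral_div, integral_neg, integral_sub hHint (integrable_const _)]
          simp
  rw [← hQ]
  have h1 : ∫ z, G z ∂P ≤ -(∫ z, (z.2 - ∫ w, F w z.1 ∂ρ) ^ 2 ∂P) / β := by linarith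
  rw [le_div_iff₀ hβ0] at h1
  linarith

end OneStep

section Telescoping

variable {X E : Type*} {F : E → X → ℝ}

/-- The cumulative quadratic loss of `F l` over the first `k` observations. -/
def cumLoss (F : E → X → ℝ) {n : ℕ} (k : ℕ) (w : Fin n → X × ℝ) (l : E) : ℝ :=
  ∑ i ∈ Finset.univ.filter (fun i : Fin n => (i : ℕ) < k), ((w i).2 - F l (w i).1) ^ 2

theorem cumLoss_nonneg {n : ℕ} (k : ℕ) (w : Fin n → X × ℝ) (l : E) : 0 ≤ cumLoss F k w l :=
  Finset.sum_nonneg fun _ _ => sq_nonneg _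

theorem cumLoss_le_sum {n : ℕ} (k : ℕ) (w : Fin n → X × ℝ) (l : E) :
    cumLoss F k w l ≤ ∑ i, ((w i).2 - F l (w i).1) ^ 2 :=
  Finset.sum_le_sum_of_subset_of_nonneg (Finset.filter_subset _ _) fun _ _ _ => sq_nonneg _

theorem cumLoss_insertNth {n : ℕ} (m : Fin (n + 1)) (z : X × ℝ) (w : Fin n → X × ℝ) (l : E) :
    cumLoss F m (m.insertNth z w : Fin (n + 1) → X × ℝ) l = cumLoss F m w l := by
  simp only [cumLoss, Finset.sum_filter]
  rw [Fin.sum_univ_succAbove _ m]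
  simp only [lt_self_iff_false, if_false, zero_add, Fin.insertNth_apply_succAbove]
  refine Finset.sum_congr rfl fun j _ => ?_
  have : ((m.succAbove j : Fin (n + 1)) : ℕ) < m ↔ (j : ℕ) < m := by
    rw [Fin.succAbove]; split_ifs with h <;> simp [Fin.lt_def] at h ⊢; omega
  simp only [this]

theorem cumLoss_succ_insertNth {n : ℕ} (m : Fin (n + 1)) (z : X × ℝ) (w : Fin n → X × ℝ)
    (l : E) :
    cumLoss F (m + 1) (m.insertNth z w : Fin (n + 1) → X × ℝ) l =
      (z.2 - F l z.1) ^ 2 + cumLoss F m w l := by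
  simp only [cumLoss, Finset.sum_filter]
  rw [Fin.sum_univ_succAbove _ m]
  simp only [lt_add_iff_pos_right, zero_lt_one, if_true, Fin.insertNth_apply_same,
    Fin.insertNth_apply_succAbove]
  congr 1
  refine Finset.sum_congr rfl fun j _ => ?_
  have : ((m.succAbove j : Fin (n + 1)) : ℕ) < m + 1 ↔ (j : ℕ) < m := by
    rw [Fin.succAbove]; split_ifs with h <;> simp [Fin.lt_def] at h ⊢; omega
  simp only [this]

variable [MeasurableSpace X] [MeasurableSpace E]

theorem measurable_cumLoss (hF : Measurable (Function.uncurry F)) (n k : ℕ) :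
    Measurable fun q : (Fin n → X × ℝ) × E => cumLoss F k q.1 q.2 := by
  refine Finset.measurable_sum _ fun i _ => ?_
  have h1 : Measurable fun q : (Fin n → X × ℝ) × E => q.1 i :=
    (measurable_pi_apply i).comp measurable_fst
  have h2 : Measurable fun q : (Fin n → X × ℝ) × E => F q.2 (q.1 i).1 :=
    hF.comp (measurable_snd.prodMk (measurable_fst.comp h1))
  fun_prop

theorem measurable_cumLoss_right (hF : Measurable (Function.uncurry F)) {n : ℕ} (k : ℕ)
    (w : Fin n → X × ℝ) : Measurable fun l => cumLoss F k w l := by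
  have h := measurable_cumLoss hF n k
  exact h.comp (f := fun l => (w, l)) (by fun_prop)

variable {P : Measure (X × ℝ)} {π : Measure E} [IsProbabilityMeasure π]
  {f : X → ℝ} {b s B D β : ℝ}

theorem integrable_exp_neg_cumLoss (hF : Measurable (Function.uncurry F)) (hβ : 0 < β) {n : ℕ}
    (k : ℕ) (w : Fin n → X × ℝ) (ν : Measure E) [IsProbabilityMeasure ν] :
    Integrable (fun l => Real.exp (-cumLoss F k w l / β)) ν := by
  have := measurable_cumLoss_right hF k w
  refine Integrable.of_bound (by fun_prop) 1 (.of_forall fun l => ?_)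
  rw [Real.norm_of_nonneg (Real.exp_pos _).le, Real.exp_le_one_iff, neg_div, neg_nonpos]
  exact div_nonneg (cumLoss_nonneg _ _ _) hβ.le

theorem measurable_integral_tilted_cumLoss (hF : Measurable (Function.uncurry F)) (n k : ℕ) :
    Measurable fun q : (Fin n → X × ℝ) × X =>
      ∫ l, F l q.2 ∂π.tilted (fun l => -cumLoss F k q.1 l / β) := by
  simp only [integral_tilted]
  have h1 := measurable_cumLoss hF n k
  have h2 : Measurable fun w : Fin n → X × ℝ => ∫ l, Real.exp (-cumLoss F k w l / β) ∂π := by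
    have : StronglyMeasurable fun q : (Fin n → X × ℝ) × E => Real.exp (-cumLoss F k q.1 q.2 / β) :=
      Measurable.stronglyMeasurable (by fun_prop)
    exact (this.integral_prod_right' (ν := π)).measurable
  have h3 : Measurable fun q : ((Fin n → X × ℝ) × X) × E => cumLoss F k q.1.1 q.2 :=
    h1.comp (f := fun q : ((Fin n → X × ℝ) × X) × E => (q.1.1, q.2)) (by fun_prop)
  have h4 : Measurable fun q : ((Fin n → X × ℝ) × X) × E => F q.2 q.1.2 :=
    hF.comp (measurable_snd.prodMk (measurable_snd.comp measurable_fst))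
  have h5 : Measurable fun q : ((Fin n → X × ℝ) × X) × E =>
      ∫ l, Real.exp (-cumLoss F k q.1.1 l / β) ∂π :=
    h2.comp (f := fun q : ((Fin n → X × ℝ) × X) × E => q.1.1) (by fun_prop)
  have : StronglyMeasurable fun q : ((Fin n → X × ℝ) × X) × E =>
      (Real.exp (-cumLoss F k q.1.1 q.2 / β) / ∫ l, Real.exp (-cumLoss F k q.1.1 l / β) ∂π) •
        F q.2 q.1.2 :=
    (((h3.neg.div_const β).exp.div h5).smul h4).stronglyMeasurable
  exact (this.integral_prod_right' (ν := π)).measurable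

theorem sq_integral_tilted_cumLoss_sub_le (hF : Measurable (Function.uncurry F))
    (hFB : ∀ᵐ x ∂P.fst, ∀ᵐ l ∂π, |F l x| ≤ B ∧ (F l x - f x) ^ 2 ≤ D) (hD : 0 ≤ D)
    (hβ : 0 < β) {n : ℕ} (k : ℕ) (w : Fin n → X × ℝ) :
    ∀ᵐ x ∂P.fst, (∫ l, F l x ∂π.tilted (fun l => -cumLoss F k w l / β) - f x) ^ 2 ≤ D := by
  have := isProbabilityMeasure_tilted (integrable_exp_neg_cumLoss hF hβ k w π)
  filter_upwards [hFB] with x hx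
  have hx' : ∀ᵐ l ∂_, _ := (tilted_absolutelyContinuous π (fun l => -cumLoss F k w l / β)).ae_le hx
  have hFx : Measurable fun l => F l x := hF.comp (measurable_id.prodMk measurable_const)
  exact sq_integral_sub_le (Integrable.of_bound hFx.aestronglyMeasurable B
    (hx'.mono fun l hl => hl.1)) hD (hx'.mono fun l hl => hl.2)

variable [IsProbabilityMeasure P]

theorem integrable_integral_sq_tilted (hf : Measurable f) (hF : Measurable (Function.uncurry F))
    (hFB : ∀ᵐ x ∂P.fst, ∀ᵐ l ∂π, |F l x| ≤ B ∧ (F l x - f x) ^ 2 ≤ D) (hD : 0 ≤ D)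
    (hβ : 0 < β) (n k : ℕ) :
    Integrable (fun w : Fin n → X × ℝ =>
      ∫ x, (∫ l, F l x ∂π.tilted (fun l => -cumLoss F k w l / β) - f x) ^ 2 ∂P.fst)
      (Measure.pi fun _ => P) := by
  have hmeas : StronglyMeasurable fun q : (Fin n → X × ℝ) × X =>
      (∫ l, F l q.2 ∂π.tilted (fun l => -cumLoss F k q.1 l / β) - f q.2) ^ 2 := by
    have := measurable_integral_tilted_cumLoss (π := π) (β := β) hF n k
    exact Measurable.stronglyMeasurable (by fun_prop)
  refine Integrable.of_bound (hmeas.integral_prod_right' (ν := P.fst)).aestronglyMeasurable D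
    (.of_forall fun w => ?_)
  have := norm_integral_le_of_norm_le_const (μ := P.fst)
    ((sq_integral_tilted_cumLoss_sub_le hF hFB hD hβ k w).mono fun x hx =>
      (Real.norm_of_nonneg (sq_nonneg _)).trans_le hx)
  simpa using this

theorem integrable_log_integral_exp_neg_cumLoss
    (hξ2 : Integrable (fun z : X × ℝ => (z.2 - f z.1) ^ 2) P)
    (hF : Measurable (Function.uncurry F))
    (hFB : ∀ᵐ x ∂P.fst, ∀ᵐ l ∂π, |F l x| ≤ B ∧ (F l x - f x) ^ 2 ≤ D)
    (hβ : 0 < β) (n k : ℕ) :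
    Integrable (fun w : Fin n → X × ℝ => Real.log (∫ l, Real.exp (-cumLoss F k w l / β) ∂π))
      (Measure.pi fun _ => P) := by
  have hmeas : Measurable fun w : Fin n → X × ℝ =>
      Real.log (∫ l, Real.exp (-cumLoss F k w l / β) ∂π) := by
    have := measurable_cumLoss hF n k
    have : StronglyMeasurable fun q : (Fin n → X × ℝ) × E => Real.exp (-cumLoss F k q.1 q.2 / β) :=
      Measurable.stronglyMeasurable (by fun_prop)
    exact (this.integral_prod_right' (ν := π)).measurable.log
  have hdom : Integrable (fun w : Fin n → X × ℝ =>
      (∑ i, (2 * ((w i).2 - f (w i).1) ^ 2 + 2 * D)) / β) (Measure.pi fun _ => P) := by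
    refine (integrable_finsetSum _ fun i _ => ?_).div_const β
    exact integrable_comp_eval (μ := fun _ : Fin n => P) (i := i)
      (f := fun z : X × ℝ => 2 * (z.2 - f z.1) ^ 2 + 2 * D)
      ((hξ2.const_mul 2).add (integrable_const _))
  refine hdom.mono' hmeas.aestronglyMeasurable ?_
  have hFB' := ae_of_ae_map (f := Prod.fst) measurable_fst.aemeasurable hFB
  have hall : ∀ᵐ w ∂(Measure.pi fun _ : Fin n => P), ∀ i, ∀ᵐ l ∂π,
      |F l (w i).1| ≤ B ∧ (F l (w i).1 - f (w i).1) ^ 2 ≤ D := by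
    rw [ae_all_iff]
    intro i
    exact (measurePreserving_eval (fun _ : Fin n => P) i).quasiMeasurePreserving.ae hFB'
  filter_upwards [hall] with w hw
  have := measurable_cumLoss_right hF k w
  refine abs_log_integral_exp_le (by fun_prop) (.of_forall fun l => ?_) ?_
  · rw [neg_div, neg_nonpos]
    exact div_nonneg (cumLoss_nonneg _ _ _) hβ.le
  · filter_upwards [ae_all_iff.2 hw] with l hl
    rw [← neg_div]
    refine div_le_div_of_nonneg_right (neg_le_neg ((cumLoss_le_sum k w l).trans ?_)) hβ.le
    refine Finset.sum_le_sum fun i _ => ?_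
    nlinarith [(hl i).2, sq_nonneg (((w i).2 - f (w i).1) + (F l (w i).1 - f (w i).1))]

theorem integral_log_increment_le (hf : Measurable f)
    (hξ2 : Integrable (fun z : X × ℝ => (z.2 - f z.1) ^ 2) P)
    (hreg : ∀ A : Set X, MeasurableSet A →
      (∫ z in {z : X × ℝ | z.1 ∈ A}, (z.2 - f z.1) ∂P) = 0)
    (hmgf : ∀ᵐ x ∂P.fst, ∀ t : ℝ, |t| ≤ b →
      ∫⁻ y, ENNReal.ofReal (Real.exp (t * (y - f x))) ∂P.condKernel x ≤
        ENNReal.ofReal (Real.exp (s * t ^ 2 / 2)))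
    (hF : Measurable (Function.uncurry F))
    (hFB : ∀ᵐ x ∂P.fst, ∀ᵐ l ∂π, |F l x| ≤ B ∧ (F l x - f x) ^ 2 ≤ D)
    (hs : 0 ≤ s) (hD : 0 ≤ D) (hβ0 : 0 < β) (hβ : 2 * s + 2 * D ≤ β) (hβb : 4 * B ≤ b * β)
    {n : ℕ} (m : Fin (n + 1)) :
    ∫ z, (z.2 - f z.1) ^ 2 ∂P +
      ∫ w, ∫ x, (∫ l, F l x ∂π.tilted (fun l => -cumLoss F m w l / β) - f x) ^ 2 ∂P.fst
        ∂(Measure.pi fun _ : Fin n => P) ≤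
      -β * ∫ ω : Fin (n + 1) → X × ℝ,
        (Real.log (∫ l, Real.exp (-cumLoss F (m + 1) ω l / β) ∂π) -
          Real.log (∫ l, Real.exp (-cumLoss F m ω l / β) ∂π)) ∂(Measure.pi fun _ => P) := by
  set J : (Fin (n + 1) → X × ℝ) → ℝ := fun ω =>
    Real.log (∫ l, Real.exp (-cumLoss F (m + 1) ω l / β) ∂π) -
      Real.log (∫ l, Real.exp (-cumLoss F m ω l / β) ∂π) with hJ
  have hJint : Integrable J (Measure.pi fun _ => P) :=
    (integrable_log_integral_exp_neg_cumLoss hξ2 hF hFB hβ0 _ _).sub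
      (integrable_log_integral_exp_neg_cumLoss hξ2 hF hFB hβ0 _ _)
  have mp := (measurePreserving_piFinSuccAbove (fun _ : Fin (n + 1) => P) m).symm
  have hJe : ∀ z w, J ((MeasurableEquiv.piFinSuccAbove (fun _ => X × ℝ) m).symm (z, w)) =
      Real.log (∫ l, Real.exp (-(z.2 - F l z.1) ^ 2 / β)
        ∂π.tilted (fun l => -cumLoss F m w l / β)) := by
    intro z w
    have he : (MeasurableEquiv.piFinSuccAbove (fun _ => X × ℝ) m).symm (z, w) =
        (m.insertNth z w : Fin (n + 1) → X × ℝ) := rfl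
    rw [he, integral_exp_tilted, hJ]
    simp only [cumLoss_insertNth, cumLoss_succ_insertNth]
    have h1 : ∀ l, ((fun l => -cumLoss F m w l / β) + fun l => -(z.2 - F l z.1) ^ 2 / β) l =
        -((z.2 - F l z.1) ^ 2 + cumLoss F m w l) / β := by
      intro l; simp only [Pi.add_apply]; ring
    simp only [h1]
    have h2 : Integrable
        (fun l => Real.exp (-((z.2 - F l z.1) ^ 2 + cumLoss F m w l) / β)) π := by
      simpa only [cumLoss_succ_insertNth] using
        integrable_exp_neg_cumLoss hF hβ0 (m + 1) (m.insertNth z w : Fin (n + 1) → X × ℝ) π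
    rw [Real.log_div (integral_exp_pos h2).ne'
      (integral_exp_pos (integrable_exp_neg_cumLoss hF hβ0 m w π)).ne']
  have hJint' : Integrable (fun q : (X × ℝ) × (Fin n → X × ℝ) =>
      J ((MeasurableEquiv.piFinSuccAbove (fun _ => X × ℝ) m).symm q))
      (P.prod (Measure.pi fun _ => P)) :=
    mp.integrable_comp_of_integrable hJint
  have hswap : ∫ ω, J ω ∂(Measure.pi fun _ => P) = ∫ w, ∫ z,
      Real.log (∫ l, Real.exp (-(z.2 - F l z.1) ^ 2 / β)
        ∂π.tilted (fun l => -cumLoss F m w l / β)) ∂P ∂(Measure.pi fun _ : Fin n => P) := by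
    rw [← mp.integral_comp' J, integral_prod_symm _ hJint']
    simp only [hJe]
  have hint : Integrable (fun w : Fin n → X × ℝ => ∫ z,
      Real.log (∫ l, Real.exp (-(z.2 - F l z.1) ^ 2 / β)
        ∂π.tilted (fun l => -cumLoss F m w l / β)) ∂P) (Measure.pi fun _ => P) := by
    simpa only [hJe] using hJint'.integral_prod_right
  rw [hswap, ← integral_const_mul]
  have hloss := integrable_integral_sq_tilted hf hF hFB hD hβ0 n m
  calc _ = ∫ w, (∫ z, (z.2 - f z.1) ^ 2 ∂P +
        ∫ x, (∫ l, F l x ∂π.tilted (fun l => -cumLoss F m w l / β) - f x) ^ 2 ∂P.fst)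
          ∂(Measure.pi fun _ : Fin n => P) := by
        rw [integral_add (integrable_const _) hloss]; simp
    _ ≤ _ := by
        refine integral_mono ((integrable_const _).add hloss) (hint.const_mul _) fun w => ?_
        have := isProbabilityMeasure_tilted (integrable_exp_neg_cumLoss hF hβ0 m w π)
        refine integral_sq_sub_integral_le hf hξ2 hreg hmgf hF ?_ hs hD hβ0 hβ hβb
        filter_upwards [hFB] with x hx
        exact (tilted_absolutelyContinuous π (fun l => -cumLoss F m w l / β)).ae_le hx

theorem neg_log_integral_exp_neg_cumLoss_le (hF : Measurable (Function.uncurry F)) (hβ : 0 < β)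
    {p : Measure E} [IsProbabilityMeasure p] {K : ℝ}
    (hp : p ≤ ENNReal.ofReal (Real.exp K) • π)
    (hpint : ∀ z : X × ℝ, Integrable (fun l => (z.2 - F l z.1) ^ 2) p)
    {n : ℕ} (w : Fin n → X × ℝ) :
    -Real.log (∫ l, Real.exp (-cumLoss F n w l / β) ∂π) ≤
      K + (∑ i, ∫ l, ((w i).2 - F l (w i).1) ^ 2 ∂p) / β := by
  have hfull : cumLoss F n w = fun l => ∑ i, ((w i).2 - F l (w i).1) ^ 2 := by
    ext l
    rw [cumLoss, Finset.filter_true_of_mem fun i _ => i.2]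
  have hcint : Integrable (fun l => -cumLoss F n w l / β) p := by
    rw [hfull]
    exact (integrable_finsetSum _ fun i _ => hpint (w i)).neg.div_const β
  have hcval : ∫ l, -cumLoss F n w l / β ∂p =
      -((∑ i, ∫ l, ((w i).2 - F l (w i).1) ^ 2 ∂p) / β) := by
    rw [hfull, integral_div, integral_neg, integral_finsetSum _ fun i _ => hpint (w i), neg_div]
  have hpexp := integrable_exp_neg_cumLoss hF hβ n w p
  have hπexp := integrable_exp_neg_cumLoss hF hβ n w π
  have hjensen : Real.exp (∫ l, -cumLoss F n w l / β ∂p) ≤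
      ∫ l, Real.exp (-cumLoss F n w l / β) ∂p :=
    convexOn_exp.map_integral_le Real.continuous_exp.continuousOn isClosed_univ
      (.of_forall fun _ => Set.mem_univ _) hcint hpexp
  have hle : ∫ l, Real.exp (-cumLoss F n w l / β) ∂p ≤
      Real.exp K * ∫ l, Real.exp (-cumLoss F n w l / β) ∂π := by
    have := integral_mono_measure hp (.of_forall fun l => (Real.exp_pos _).le)
      (hπexp.smul_measure ENNReal.ofReal_ne_top)
    rwa [integral_smul_measure, ENNReal.toReal_ofReal (Real.exp_pos _).le, smul_eq_mul] at this
  have hlog := Real.log_le_log (Real.exp_pos _) (hjensen.trans hle)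
  rw [Real.log_exp, hcval, Real.log_mul (Real.exp_pos _).ne' (integral_exp_pos hπexp).ne',
    Real.log_exp] at hlog
  linarith

theorem sum_integral_sq_tilted_le (hf : Measurable f)
    (hξ2 : Integrable (fun z : X × ℝ => (z.2 - f z.1) ^ 2) P)
    (hreg : ∀ A : Set X, MeasurableSet A →
      (∫ z in {z : X × ℝ | z.1 ∈ A}, (z.2 - f z.1) ∂P) = 0)
    (hmgf : ∀ᵐ x ∂P.fst, ∀ t : ℝ, |t| ≤ b →
      ∫⁻ y, ENNReal.ofReal (Real.exp (t * (y - f x))) ∂P.condKernel x ≤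
        ENNReal.ofReal (Real.exp (s * t ^ 2 / 2)))
    (hF : Measurable (Function.uncurry F))
    (hFB : ∀ᵐ x ∂P.fst, ∀ᵐ l ∂π, |F l x| ≤ B ∧ (F l x - f x) ^ 2 ≤ D)
    (hs : 0 ≤ s) (hD : 0 ≤ D) (hβ0 : 0 < β) (hβ : 2 * s + 2 * D ≤ β) (hβb : 4 * B ≤ b * β)
    {p : Measure E} [IsProbabilityMeasure p] {K : ℝ}
    (hp : p ≤ ENNReal.ofReal (Real.exp K) • π)
    (hpint : ∀ z : X × ℝ, Integrable (fun l => (z.2 - F l z.1) ^ 2) p)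
    (hpP : Integrable (fun z : X × ℝ => ∫ l, (z.2 - F l z.1) ^ 2 ∂p) P) (n : ℕ) :
    ∑ m ∈ Finset.range (n + 1),
      ∫ w, ∫ x, (∫ l, F l x ∂π.tilted (fun l => -cumLoss F m w l / β) - f x) ^ 2 ∂P.fst
        ∂(Measure.pi fun _ : Fin n => P) ≤
      β * K + (n + 1) *
        (∫ z, ∫ l, (z.2 - F l z.1) ^ 2 ∂p ∂P - ∫ z, (z.2 - f z.1) ^ 2 ∂P) := by
  set G : ℕ → (Fin (n + 1) → X × ℝ) → ℝ := fun k ω =>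
    Real.log (∫ l, Real.exp (-cumLoss F k ω l / β) ∂π) with hG
  have hGint : ∀ k, Integrable (G k) (Measure.pi fun _ => P) := fun k =>
    integrable_log_integral_exp_neg_cumLoss hξ2 hF hFB hβ0 _ _
  have hG0 : ∀ ω, G 0 ω = 0 := by
    intro ω; simp [hG, cumLoss]
  have hsum := Finset.sum_le_sum fun m (_ : m ∈ (Finset.univ : Finset (Fin (n + 1)))) =>
    integral_log_increment_le hf hξ2 hreg hmgf hF hFB hs hD hβ0 hβ hβb m
  rw [Finset.sum_add_distrib, ← Finset.mul_sum, Fin.sum_univ_eq_sum_range (fun m => ∫ w, ∫ x,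
    (∫ l, F l x ∂π.tilted (fun l => -cumLoss F m w l / β) - f x) ^ 2 ∂P.fst
      ∂(Measure.pi fun _ : Fin n => P)),
    Fin.sum_univ_eq_sum_range (fun m => ∫ ω, (G (m + 1) ω - G m ω) ∂(Measure.pi fun _ => P))]
    at hsum
  have htel : ∑ m ∈ Finset.range (n + 1), ∫ ω, (G (m + 1) ω - G m ω) ∂(Measure.pi fun _ => P) =
      ∫ ω, G (n + 1) ω ∂(Measure.pi fun _ => P) := by
    simp_rw [integral_sub (hGint _) (hGint _)]
    rw [Finset.sum_range_sub (fun m => ∫ ω, G m ω ∂(Measure.pi fun _ => P))]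
    simp [hG0]
  have hcomp : ∀ i, Integrable (fun ω : Fin (n + 1) → X × ℝ =>
      ∫ l, ((ω i).2 - F l (ω i).1) ^ 2 ∂p) (Measure.pi fun _ => P) := fun i =>
    integrable_comp_eval (μ := fun _ : Fin (n + 1) => P) (i := i)
      (f := fun z : X × ℝ => ∫ l, (z.2 - F l z.1) ^ 2 ∂p) hpP
  have hlast : -∫ ω, G (n + 1) ω ∂(Measure.pi fun _ => P) ≤
      K + ((n + 1) * ∫ z, ∫ l, (z.2 - F l z.1) ^ 2 ∂p ∂P) / β := by
    have hsumint := (integrable_finsetSum Finset.univ fun i _ => hcomp i).div_const β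
    calc _ = ∫ ω, -G (n + 1) ω ∂(Measure.pi fun _ => P) := (integral_neg _).symm
      _ ≤ ∫ ω, (K + (∑ i, ∫ l, ((ω i).2 - F l (ω i).1) ^ 2 ∂p) / β)
            ∂(Measure.pi fun _ : Fin (n + 1) => P) :=
          integral_mono (hGint _).neg ((integrable_const _).add hsumint) fun ω =>
            neg_log_integral_exp_neg_cumLoss_le hF hβ0 hp hpint ω
      _ = _ := by
          rw [integral_add (integrable_const _) hsumint, integral_div,
            integral_finsetSum _ fun i _ => hcomp i]
          have : ∀ i : Fin (n + 1), ∫ ω : Fin (n + 1) → X × ℝ,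
              (∫ l, ((ω i).2 - F l (ω i).1) ^ 2 ∂p) ∂(Measure.pi fun _ => P) =
              ∫ z, ∫ l, (z.2 - F l z.1) ^ 2 ∂p ∂P := fun i =>
            integral_comp_eval (μ := fun _ : Fin (n + 1) => P) (i := i)
              (f := fun z : X × ℝ => ∫ l, (z.2 - F l z.1) ^ 2 ∂p) hpP.aestronglyMeasurable
          simp [this]
  rw [htel] at hsum
  simp only [Finset.sum_const, Finset.card_univ, Fintype.card_fin, nsmul_eq_mul] at hsum
  push_cast at hsum
  have h3 := mul_le_mul_of_nonneg_left hlast hβ0.le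
  rw [mul_add, mul_div_cancel₀ _ hβ0.ne'] at h3
  linarith

end Telescoping

section SparsityPrior

/-- The unnormalized scaled Student density with three degrees of freedom. -/
noncomputable def studentWeight (τ t : ℝ) : ℝ := ((τ ^ 2 + t ^ 2) ^ 2)⁻¹

variable {τ : ℝ}

theorem studentWeight_pos (hτ : 0 < τ) (t : ℝ) : 0 < studentWeight τ t := by
  unfold studentWeight; positivity

theorem measurable_studentWeight : Measurable (studentWeight τ) := by
  unfold studentWeight; fun_prop

theorem integrable_inv_sq_add_sq (hτ : 0 < τ) : Integrable fun t : ℝ => (τ ^ 2 + t ^ 2)⁻¹ := by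
  have h := ((integrable_inv_one_add_sq.comp_div hτ.ne').const_mul (τ ^ 2)⁻¹)
  refine h.congr (.of_forall fun t => ?_)
  simp only
  rw [← mul_inv]
  congr 1
  field_simp

theorem integrable_sq_mul_studentWeight (hτ : 0 < τ) :
    Integrable fun t : ℝ => t ^ 2 * studentWeight τ t := by
  refine (integrable_inv_sq_add_sq hτ).mono'
    (by have := measurable_studentWeight (τ := τ); fun_prop) (.of_forall fun t => ?_)
  have hw := studentWeight_pos hτ t
  rw [Real.norm_of_nonneg (by positivity), studentWeight, ← div_eq_mul_inv,
    div_le_iff₀ (by positivity), sq (τ ^ 2 + t ^ 2), inv_mul_cancel_left₀ (by positivity)]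
  nlinarith [sq_nonneg τ]

theorem integrable_studentWeight (hτ : 0 < τ) : Integrable (studentWeight τ) := by
  have h := ((integrable_inv_sq_add_sq hτ).sub (integrable_sq_mul_studentWeight hτ)).const_mul
    (τ ^ 2)⁻¹
  refine h.congr (.of_forall fun t => ?_)
  simp only [Pi.sub_apply, studentWeight]
  field_simp
  ring

theorem integral_sq_mul_studentWeight (hτ : 0 < τ) :
    ∫ t, t ^ 2 * studentWeight τ t = τ ^ 2 * ∫ t, studentWeight τ t := by
  have hint := ((integrable_studentWeight hτ).const_mul (τ ^ 2)).sub
    (integrable_sq_mul_studentWeight hτ)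
  have hderiv : ∀ t : ℝ, HasDerivAt (fun t : ℝ => t / (τ ^ 2 + t ^ 2))
      (((fun t => τ ^ 2 * studentWeight τ t) - fun t => t ^ 2 * studentWeight τ t) t) t := by
    intro t
    have := (hasDerivAt_id t).div (((hasDerivAt_id t).pow 2).const_add (τ ^ 2))
      (by simp only [Pi.pow_apply, id]; positivity)
    convert! this using 1
    simp only [Pi.sub_apply, studentWeight, id, Pi.pow_apply]
    field_simp
    push_cast
    ring
  have hlim : Filter.Tendsto (fun t : ℝ => t / (τ ^ 2 + t ^ 2)) Filter.atTop (nhds 0) := by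
    refine squeeze_zero' (g := fun t : ℝ => t⁻¹) ?_ ?_ tendsto_inv_atTop_zero
    · filter_upwards [Filter.eventually_gt_atTop 0] with t ht
      positivity
    · filter_upwards [Filter.eventually_gt_atTop 0] with t ht
      rw [div_le_iff₀ (by positivity), inv_mul_eq_div, le_div_iff₀ ht]
      nlinarith [sq_nonneg τ]
  have hlim' : Filter.Tendsto (fun t : ℝ => t / (τ ^ 2 + t ^ 2)) Filter.atBot (nhds 0) := by
    have := (hlim.comp Filter.tendsto_neg_atBot_atTop).neg
    simpa [Function.comp_def, neg_div] using this
  have h0 := integral_of_hasDerivAt_of_tendsto hderiv hint hlim' hlim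
  simp only [Pi.sub_apply] at h0
  rw [integral_sub ((integrable_studentWeight hτ).const_mul (τ ^ 2))
    (integrable_sq_mul_studentWeight hτ), integral_const_mul] at h0
  linarith

theorem abs_mul_studentWeight_le (hτ : 0 < τ) (t : ℝ) :
    |t| * studentWeight τ t ≤
      τ / 2 * studentWeight τ t + (2 * τ)⁻¹ * (t ^ 2 * studentWeight τ t) := by
  have h : |t| ≤ τ / 2 + (2 * τ)⁻¹ * t ^ 2 := by
    rw [← sq_abs t]
    have : τ / 2 + (2 * τ)⁻¹ * |t| ^ 2 - |t| = (2 * τ)⁻¹ * (τ - |t|) ^ 2 := by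
      field_simp; ring
    have : 0 ≤ (2 * τ)⁻¹ * (τ - |t|) ^ 2 := by positivity
    linarith
  nlinarith [mul_le_mul_of_nonneg_right h (studentWeight_pos hτ t).le]

theorem integrable_abs_mul_studentWeight (hτ : 0 < τ) :
    Integrable fun t : ℝ => |t| * studentWeight τ t := by
  refine (((integrable_studentWeight hτ).const_mul (τ / 2)).add
    ((integrable_sq_mul_studentWeight hτ).const_mul (2 * τ)⁻¹)).mono'
    (by have := measurable_studentWeight (τ := τ); fun_prop) (.of_forall fun t => ?_)
  rw [Real.norm_of_nonneg (mul_nonneg (abs_nonneg t) (studentWeight_pos hτ t).le)]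
  exact abs_mul_studentWeight_le hτ t

theorem integral_abs_mul_studentWeight_le (hτ : 0 < τ) :
    ∫ t, |t| * studentWeight τ t ≤ τ * ∫ t, studentWeight τ t := by
  have h1 := (integrable_studentWeight hτ).const_mul (τ / 2)
  have h2 := (integrable_sq_mul_studentWeight hτ).const_mul (2 * τ)⁻¹
  have h := integral_mono (integrable_abs_mul_studentWeight hτ) (h1.add h2)
    (abs_mul_studentWeight_le hτ)
  refine h.trans_eq ?_
  simp only [Pi.add_apply]
  rw [integral_add h1 h2, integral_const_mul, integral_const_mul,
    integral_sq_mul_studentWeight hτ]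
  field_simp
  ring

theorem studentWeight_sub_le (hτ : 0 < τ) (t a : ℝ) :
    studentWeight τ (t - a) ≤ (1 + τ⁻¹ * |a|) ^ 4 * studentWeight τ t := by
  unfold studentWeight
  rw [← div_eq_mul_inv, le_div_iff₀ (by positivity), inv_mul_le_iff₀ (by positivity)]
  have key : τ ^ 2 + t ^ 2 ≤ (τ ^ 2 + (t - a) ^ 2) * (1 + τ⁻¹ * |a|) ^ 2 := by
    set x := τ⁻¹ * |a| with hx
    have hx0 : 0 ≤ x := by positivity
    have ha : |a| = τ * x := by rw [hx]; field_simp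
    have h1 : |t| ≤ |t - a| + τ * x := by
      rw [← ha]; simpa using abs_add_le (t - a) a
    have h2 : t ^ 2 ≤ (|t - a| + τ * x) ^ 2 := by
      rw [← sq_abs t]; exact pow_le_pow_left₀ (abs_nonneg _) h1 2
    rw [← sq_abs (t - a)]
    nlinarith [mul_nonneg hx0 (sq_nonneg (τ - |t - a|)), mul_nonneg hx0 (sq_nonneg (|t - a|)),
      mul_nonneg (sq_nonneg x) (sq_nonneg (|t - a|))]
  calc (τ ^ 2 + t ^ 2) ^ 2 ≤ ((τ ^ 2 + (t - a) ^ 2) * (1 + τ⁻¹ * |a|) ^ 2) ^ 2 :=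
        pow_le_pow_left₀ (by positivity) key 2
    _ = _ := by ring

variable {M : ℕ}

theorem integrable_prod_studentWeight (hτ : 0 < τ) :
    Integrable fun u : Fin M → ℝ => ∏ j, studentWeight τ (u j) :=
  Integrable.fintype_prod (f := fun _ => studentWeight τ) fun _ => integrable_studentWeight hτ

theorem integrable_mul_prod_studentWeight (hτ : 0 < τ) {g : ℝ → ℝ}
    (hg : Integrable fun t => g t * studentWeight τ t) (k : Fin M) :
    (Integrable fun u : Fin M → ℝ => g (u k) * ∏ j, studentWeight τ (u j)) ∧
      (∫ t, studentWeight τ t) * ∫ u : Fin M → ℝ, g (u k) * ∏ j, studentWeight τ (u j) =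
        (∫ t, g t * studentWeight τ t) * ∫ u : Fin M → ℝ, ∏ j, studentWeight τ (u j) := by
  set h : Fin M → ℝ → ℝ := fun i t => if i = k then g t * studentWeight τ t else studentWeight τ t
    with hh
  have hprod : (fun u : Fin M → ℝ => g (u k) * ∏ j, studentWeight τ (u j)) =
      fun u => ∏ j, h j (u j) := by
    ext u
    rw [Fintype.prod_eq_mul_prod_compl k, Fintype.prod_eq_mul_prod_compl k]
    simp only [hh, if_true]
    rw [mul_assoc]
    congr 2
    refine Finset.prod_congr rfl fun j hj => ?_
    rw [if_neg (by simpa using hj)]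
  rw [hprod]
  constructor
  · refine Integrable.fintype_prod fun i => ?_
    simp only [hh]
    split_ifs
    · exact hg
    · exact integrable_studentWeight hτ
  · rw [integral_fintype_prod_volume_eq_prod, integral_fintype_prod_volume_eq_prod
      (fun _ => studentWeight τ), Fintype.prod_eq_mul_prod_compl k,
      Fintype.prod_eq_mul_prod_compl k]
    simp only [hh, if_true]
    have : ∏ i ∈ ({k} : Finset (Fin M))ᶜ, ∫ t, (if i = k then g t * studentWeight τ t
        else studentWeight τ t) = ∏ i ∈ ({k} : Finset (Fin M))ᶜ, ∫ t, studentWeight τ t := by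
      refine Finset.prod_congr rfl fun j hj => ?_
      simp only [if_neg (show j ≠ k by simpa using hj)]
    rw [this]
    ring

/-- The product Student density, restricted to an `ℓ¹` ball of radius `r` and unnormalized. -/
noncomputable def truncatedStudent (τ r : ℝ) (u : Fin M → ℝ) : ℝ :=
  if ∑ j, |u j| ≤ r then ∏ j, studentWeight τ (u j) else 0

theorem truncatedStudent_nonneg (hτ : 0 < τ) (r : ℝ) (u : Fin M → ℝ) :
    0 ≤ truncatedStudent τ r u := by
  unfold truncatedStudent
  split_ifs
  · exact Finset.prod_nonneg fun j _ => (studentWeight_pos hτ _).le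
  · exact le_rfl

theorem truncatedStudent_le (hτ : 0 < τ) (r : ℝ) (u : Fin M → ℝ) :
    truncatedStudent τ r u ≤ ∏ j, studentWeight τ (u j) := by
  unfold truncatedStudent
  split_ifs
  · exact le_rfl
  · exact Finset.prod_nonneg fun j _ => (studentWeight_pos hτ _).le

theorem measurable_truncatedStudent (r : ℝ) :
    Measurable (truncatedStudent τ r : (Fin M → ℝ) → ℝ) := by
  have h := measurable_studentWeight (τ := τ)
  exact Measurable.ite (measurableSet_le (by fun_prop) measurable_const)
    (Finset.measurable_prod _ fun j _ => h.comp (measurable_pi_apply j)) measurable_const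

theorem integrable_truncatedStudent (hτ : 0 < τ) (r : ℝ) :
    Integrable (truncatedStudent τ r : (Fin M → ℝ) → ℝ) := by
  refine (integrable_prod_studentWeight hτ).mono'
    (measurable_truncatedStudent r).aestronglyMeasurable (.of_forall fun u => ?_)
  rw [Real.norm_of_nonneg (truncatedStudent_nonneg hτ r u)]
  exact truncatedStudent_le hτ r u

theorem integral_studentWeight_pos (hτ : 0 < τ) : 0 < ∫ t, studentWeight τ t := by
  rw [integral_pos_iff_support_of_nonneg (fun t => (studentWeight_pos hτ t).le)
    (integrable_studentWeight hτ)]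
  have : Function.support (studentWeight τ) = Set.univ :=
    Set.eq_univ_of_forall fun t => (studentWeight_pos hτ t).ne'
  simp [this]

theorem integral_prod_studentWeight_pos (hτ : 0 < τ) :
    0 < ∫ u : Fin M → ℝ, ∏ j, studentWeight τ (u j) := by
  rw [integral_fintype_prod_volume_eq_prod (fun _ => studentWeight τ)]
  exact Finset.prod_pos fun _ _ => integral_studentWeight_pos hτ

theorem integral_prod_studentWeight_le (hτ : 0 < τ) (hM : 0 < M) :
    ∫ u : Fin M → ℝ, ∏ j, studentWeight τ (u j) ≤
      2 * ∫ u : Fin M → ℝ, truncatedStudent τ (2 * M * τ) u := by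
  have hM' : (0 : ℝ) < M := Nat.cast_pos.2 hM
  have hI := integral_studentWeight_pos hτ
  set Z := ∫ u : Fin M → ℝ, ∏ j, studentWeight τ (u j) with hZ
  have hZpos : 0 < Z := integral_prod_studentWeight_pos hτ
  have habs := fun k : Fin M => integrable_mul_prod_studentWeight hτ (g := fun t => |t|)
    (integrable_abs_mul_studentWeight hτ) k
  have hmoment : ∀ k : Fin M, ∫ u : Fin M → ℝ, |u k| * ∏ j, studentWeight τ (u j) ≤ τ * Z := by
    intro k
    refine le_of_mul_le_mul_left ?_ hI
    rw [(habs k).2]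
    have := mul_le_mul_of_nonneg_right (integral_abs_mul_studentWeight_le hτ) hZpos.le
    linarith
  have hpt : ∀ u : Fin M → ℝ, ∏ j, studentWeight τ (u j) ≤ truncatedStudent τ (2 * M * τ) u +
      (2 * M * τ)⁻¹ * ∑ k, |u k| * ∏ j, studentWeight τ (u j) := by
    intro u
    have hW : 0 ≤ ∏ j, studentWeight τ (u j) :=
      Finset.prod_nonneg fun j _ => (studentWeight_pos hτ _).le
    rw [← Finset.sum_mul, truncatedStudent]
    split_ifs with h
    · have : 0 ≤ (2 * M * τ)⁻¹ * ((∑ k, |u k|) * ∏ j, studentWeight τ (u j)) := by positivity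
      linarith
    · rw [zero_add, ← mul_assoc]
      refine le_mul_of_one_le_left hW ?_
      rw [inv_mul_eq_div, le_div_iff₀ (by positivity)]
      linarith
  have hsum := integrable_finsetSum (Finset.univ : Finset (Fin M)) fun k _ => (habs k).1
  have h := integral_mono (integrable_prod_studentWeight hτ)
    ((integrable_truncatedStudent hτ (2 * M * τ)).add (hsum.const_mul (2 * M * τ)⁻¹)) hpt
  simp only [Pi.add_apply] at h
  rw [integral_add (integrable_truncatedStudent hτ _) (hsum.const_mul _), integral_const_mul,
    integral_finsetSum _ fun k _ => (habs k).1] at h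
  have hle : (2 * M * τ)⁻¹ * ∑ k : Fin M, ∫ u : Fin M → ℝ, |u k| * ∏ j, studentWeight τ (u j) ≤
      Z / 2 := by
    calc _ ≤ (2 * M * τ)⁻¹ * ∑ _k : Fin M, τ * Z :=
          mul_le_mul_of_nonneg_left (Finset.sum_le_sum fun k _ => hmoment k) (by positivity)
      _ = Z / 2 := by
          rw [Finset.sum_const, Finset.card_univ, Fintype.card_fin, nsmul_eq_mul]
          field_simp
  linarith

theorem integral_sq_mul_truncatedStudent_le (hτ : 0 < τ) (hM : 0 < M) (k : Fin M) :
    ∫ u : Fin M → ℝ, u k ^ 2 * truncatedStudent τ (2 * M * τ) u ≤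
      2 * τ ^ 2 * ∫ u : Fin M → ℝ, truncatedStudent τ (2 * M * τ) u := by
  have hI := integral_studentWeight_pos hτ
  obtain ⟨hint, hval⟩ := integrable_mul_prod_studentWeight hτ (g := fun t => t ^ 2)
    (integrable_sq_mul_studentWeight hτ) k
  have h1 : ∫ u : Fin M → ℝ, u k ^ 2 * truncatedStudent τ (2 * M * τ) u ≤
      ∫ u : Fin M → ℝ, u k ^ 2 * ∏ j, studentWeight τ (u j) := by
    refine integral_mono_of_nonneg (.of_forall fun u => ?_) hint (.of_forall fun u => ?_)
    · exact mul_nonneg (sq_nonneg _) (truncatedStudent_nonneg hτ _ _)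
    · exact mul_le_mul_of_nonneg_left (truncatedStudent_le hτ _ _) (sq_nonneg _)
  have h2 : ∫ u : Fin M → ℝ, u k ^ 2 * ∏ j, studentWeight τ (u j) =
      τ ^ 2 * ∫ u : Fin M → ℝ, ∏ j, studentWeight τ (u j) := by
    refine mul_left_cancel₀ hI.ne' ?_
    rw [hval, integral_sq_mul_studentWeight hτ]
    ring
  have h3 := mul_le_mul_of_nonneg_left (integral_prod_studentWeight_le hτ hM) (sq_nonneg τ)
  linarith

/-- Change of sign of the `k`-th coordinate. -/
def negCoord (k : Fin M) (u : Fin M → ℝ) : Fin M → ℝ := fun i => if i = k then -u i else u i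

theorem integral_eq_zero_of_negCoord {g : (Fin M → ℝ) → ℝ} (hg : Measurable g) (k : Fin M)
    (h : ∀ u, g (negCoord k u) = -g u) : ∫ u, g u = 0 := by
  have hmp : MeasurePreserving (negCoord k : (Fin M → ℝ) → Fin M → ℝ) := by
    have := volume_preserving_pi (f := fun i (t : ℝ) => if i = k then -t else t) fun i => by
      by_cases hi : i = k
      · simpa [hi] using Measure.measurePreserving_neg (volume : Measure ℝ)
      · simp only [hi, if_false]
        exact MeasurePreserving.id _
    exact this
  have h1 : ∫ u, g u = ∫ u, g (negCoord k u) := by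
    conv_lhs => rw [← hmp.map_eq]
    exact integral_map hmp.measurable.aemeasurable hg.aestronglyMeasurable
  simp only [h, integral_neg] at h1
  linarith

theorem truncatedStudent_negCoord (r : ℝ) (k : Fin M) (u : Fin M → ℝ) :
    truncatedStudent τ r (negCoord k u) = truncatedStudent τ r u := by
  have h1 : ∀ j, |negCoord k u j| = |u j| := by
    intro j; unfold negCoord; split_ifs <;> simp
  have h2 : ∀ j, studentWeight τ (negCoord k u j) = studentWeight τ (u j) := by
    intro j; unfold negCoord studentWeight; split_ifs <;> simp
  simp only [truncatedStudent, h1, h2]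

theorem integral_coord_mul_truncatedStudent (r : ℝ) (k : Fin M) :
    ∫ u : Fin M → ℝ, u k * truncatedStudent τ r u = 0 := by
  have := measurable_truncatedStudent (τ := τ) (M := M) r
  refine integral_eq_zero_of_negCoord (by fun_prop) k fun u => ?_
  rw [truncatedStudent_negCoord]
  simp [negCoord]

theorem integral_coord_mul_coord_mul_truncatedStudent (r : ℝ) {i k : Fin M} (hik : i ≠ k) :
    ∫ u : Fin M → ℝ, u i * u k * truncatedStudent τ r u = 0 := by
  have := measurable_truncatedStudent (τ := τ) (M := M) r
  refine integral_eq_zero_of_negCoord (by fun_prop) k fun u => ?_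
  rw [truncatedStudent_negCoord]
  simp [negCoord, hik]

theorem integrable_mul_truncatedStudent (hτ : 0 < τ) {r : ℝ} {g : (Fin M → ℝ) → ℝ}
    (hg : Measurable g) {C : ℝ} (hC : ∀ u, ∑ j, |u j| ≤ r → |g u| ≤ C) :
    Integrable fun u => g u * truncatedStudent τ r u := by
  refine ((integrable_truncatedStudent hτ r).const_mul C).mono'
    (hg.mul (measurable_truncatedStudent r)).aestronglyMeasurable (.of_forall fun u => ?_)
  rw [Real.norm_eq_abs, abs_mul, abs_of_nonneg (truncatedStudent_nonneg hτ r u)]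
  by_cases h : ∑ j, |u j| ≤ r
  · exact mul_le_mul_of_nonneg_right (hC u h) (truncatedStudent_nonneg hτ r u)
  · simp [truncatedStudent, h]

theorem integral_sq_sub_sum_mul_truncatedStudent (hτ : 0 < τ) (r d : ℝ) (a : Fin M → ℝ) :
    (Integrable fun u : Fin M → ℝ => (d - ∑ j, u j * a j) ^ 2 * truncatedStudent τ r u) ∧
    ∫ u : Fin M → ℝ, (d - ∑ j, u j * a j) ^ 2 * truncatedStudent τ r u =
      d ^ 2 * (∫ u : Fin M → ℝ, truncatedStudent τ r u) +
        ∑ j, (∫ u : Fin M → ℝ, u j ^ 2 * truncatedStudent τ r u) * a j ^ 2 := by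
  have hcoord : ∀ u : Fin M → ℝ, ∑ j, |u j| ≤ r → ∀ i, |u i| ≤ r := fun u hu i =>
    (Finset.single_le_sum (f := fun j => |u j|) (fun j _ => abs_nonneg _)
      (Finset.mem_univ i)).trans hu
  have h1 : ∀ i, Integrable fun u : Fin M → ℝ => u i * truncatedStudent τ r u := fun i =>
    integrable_mul_truncatedStudent hτ (measurable_pi_apply i) fun u hu => hcoord u hu i
  have h2 : ∀ i k, Integrable fun u : Fin M → ℝ => u i * u k * truncatedStudent τ r u :=
    fun i k => integrable_mul_truncatedStudent hτ (by fun_prop) (C := r * r) fun u hu => by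
      rw [abs_mul]
      exact mul_le_mul (hcoord u hu i) (hcoord u hu k) (abs_nonneg _)
        ((abs_nonneg _).trans (hcoord u hu i))
  have hA : Integrable fun u : Fin M → ℝ => d ^ 2 * truncatedStudent τ r u :=
    (integrable_truncatedStudent hτ r).const_mul _
  have hB : Integrable fun u : Fin M → ℝ => ∑ i, -2 * d * a i * (u i * truncatedStudent τ r u) :=
    integrable_finsetSum _ fun i _ => (h1 i).const_mul _
  have hC : Integrable fun u : Fin M → ℝ =>
      ∑ i, ∑ k, a i * a k * (u i * u k * truncatedStudent τ r u) :=
    integrable_finsetSum _ fun i _ => integrable_finsetSum _ fun k _ => (h2 i k).const_mul _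
  have hexpand : (fun u : Fin M → ℝ => (d - ∑ j, u j * a j) ^ 2 * truncatedStudent τ r u) =
      fun u => d ^ 2 * truncatedStudent τ r u +
        ∑ i, -2 * d * a i * (u i * truncatedStudent τ r u) +
        ∑ i, ∑ k, a i * a k * (u i * u k * truncatedStudent τ r u) := by
    ext u
    have e1 : ∑ i, -2 * d * a i * (u i * truncatedStudent τ r u) =
        -2 * d * (∑ i, u i * a i) * truncatedStudent τ r u := by
      rw [Finset.mul_sum, Finset.sum_mul]
      exact Finset.sum_congr rfl fun i _ => by ring
    have e2 : ∑ i, ∑ k, a i * a k * (u i * u k * truncatedStudent τ r u) =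
        (∑ i, u i * a i) * (∑ k, u k * a k) * truncatedStudent τ r u := by
      rw [Finset.sum_mul_sum, Finset.sum_mul]
      refine Finset.sum_congr rfl fun i _ => ?_
      rw [Finset.sum_mul]
      exact Finset.sum_congr rfl fun k _ => by ring
    rw [e1, e2]
    ring
  rw [hexpand]
  have hAB : Integrable fun u : Fin M → ℝ => d ^ 2 * truncatedStudent τ r u +
      ∑ i, -2 * d * a i * (u i * truncatedStudent τ r u) := hA.add hB
  refine ⟨hAB.add hC, ?_⟩
  rw [integral_add hAB hC, integral_add hA hB, integral_const_mul,
    integral_finsetSum _ fun i _ => (h1 i).const_mul _,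
    integral_finsetSum _ fun i _ => integrable_finsetSum _ fun k _ => (h2 i k).const_mul _]
  have e1 : ∑ i, ∫ u : Fin M → ℝ, -2 * d * a i * (u i * truncatedStudent τ r u) = 0 :=
    Finset.sum_eq_zero fun i _ => by
      rw [integral_const_mul, integral_coord_mul_truncatedStudent, mul_zero]
  rw [e1, add_zero]
  congr 1
  refine Finset.sum_congr rfl fun i _ => ?_
  rw [integral_finsetSum _ fun k _ => (h2 i k).const_mul _, Finset.sum_eq_single i]
  · rw [integral_const_mul, mul_comm, sq (a i)]
    simp only [sq]
  · intro k _ hk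
    rw [integral_const_mul, integral_coord_mul_coord_mul_truncatedStudent r hk.symm, mul_zero]
  · simp

theorem exists_translated_prior (hM : 0 < M) (hτ : 0 < τ) {R c : ℝ} (hc : 0 < c)
    {π : Measure (Fin M → ℝ)}
    (hπ : π = volume.withDensity fun l => ENNReal.ofReal (c * truncatedStudent τ R l))
    [IsProbabilityMeasure π] {a : Fin M → ℝ} (ha : ∑ j, |a j| ≤ R - 2 * M * τ) :
    ∃ (p : Measure (Fin M → ℝ)) (v : Fin M → ℝ), IsProbabilityMeasure p ∧
      p ≤ ENNReal.ofReal (Real.exp (4 * ∑ j, Real.log (1 + τ⁻¹ * |a j|) + 1)) • π ∧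
      (∀ j, v j ≤ 4 * τ ^ 2) ∧
      ∀ (y : ℝ) (g : Fin M → ℝ), Integrable (fun l => (y - ∑ j, l j * g j) ^ 2) p ∧
        ∫ l, (y - ∑ j, l j * g j) ^ 2 ∂p = (y - ∑ j, a j * g j) ^ 2 + ∑ j, v j * g j ^ 2 := by
  set r : ℝ := 2 * M * τ with hr
  set Z := ∫ u : Fin M → ℝ, ∏ j, studentWeight τ (u j) with hZ
  set A := ∫ u : Fin M → ℝ, truncatedStudent τ r u with hA
  have hZpos : 0 < Z := integral_prod_studentWeight_pos hτ
  have hZA : Z ≤ 2 * A := integral_prod_studentWeight_le hτ hM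
  have hApos : 0 < A := by linarith
  have hcZ : 1 ≤ c * Z := by
    have h1 : π Set.univ = 1 := measure_univ
    rw [hπ, withDensity_apply _ MeasurableSet.univ, Measure.restrict_univ,
      ← ofReal_integral_eq_lintegral_ofReal ((integrable_truncatedStudent hτ R).const_mul c)
        (.of_forall fun u => mul_nonneg hc.le (truncatedStudent_nonneg hτ R u)),
      ENNReal.ofReal_eq_one, integral_const_mul] at h1
    rw [← h1]
    exact mul_le_mul_of_nonneg_left (integral_mono (integrable_truncatedStudent hτ R)
      (integrable_prod_studentWeight hτ) (truncatedStudent_le hτ R)) hc.le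
  have hmeas : Measurable fun l : Fin M → ℝ => A⁻¹ * truncatedStudent τ r (l - a) :=
    ((measurable_truncatedStudent r).comp (measurable_id.sub_const a)).const_mul _
  have hnonneg : ∀ l : Fin M → ℝ, 0 ≤ A⁻¹ * truncatedStudent τ r (l - a) := fun l =>
    mul_nonneg (inv_nonneg.2 hApos.le) (truncatedStudent_nonneg hτ r _)
  set p : Measure (Fin M → ℝ) :=
    volume.withDensity fun l => ENNReal.ofReal (A⁻¹ * truncatedStudent τ r (l - a)) with hp
  refine ⟨p, fun j => A⁻¹ * ∫ u : Fin M → ℝ, u j ^ 2 * truncatedStudent τ r u, ?_, ?_, ?_, ?_⟩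
  · refine ⟨?_⟩
    rw [hp, withDensity_apply _ MeasurableSet.univ, Measure.restrict_univ,
      ← ofReal_integral_eq_lintegral_ofReal
        (((integrable_truncatedStudent hτ r).comp_sub_right a).const_mul A⁻¹)
        (.of_forall hnonneg), ENNReal.ofReal_eq_one, integral_const_mul,
      integral_sub_right_eq_self (truncatedStudent τ r) a]
    exact inv_mul_cancel₀ hApos.ne'
  · have hπmeas : Measurable fun l : Fin M → ℝ =>
        ENNReal.ofReal (c * truncatedStudent τ R l) :=
      ((measurable_truncatedStudent R).const_mul c).ennreal_ofReal
    rw [hπ, ← withDensity_smul _ hπmeas]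
    refine withDensity_mono (.of_forall fun l => ?_)
    simp only [Pi.smul_apply, smul_eq_mul]
    rw [← ENNReal.ofReal_mul (Real.exp_pos _).le]
    refine ENNReal.ofReal_le_ofReal ?_
    by_cases hl : ∑ j, |(l - a) j| ≤ r
    · have hlR : ∑ j, |l j| ≤ R := by
        have : ∑ j, |l j| ≤ ∑ j, (|(l - a) j| + |a j|) :=
          Finset.sum_le_sum fun j _ => by simpa using abs_add_le (l j - a j) (a j)
        rw [Finset.sum_add_distrib] at this
        linarith
      have hW : 0 ≤ ∏ j, studentWeight τ (l j) :=
        Finset.prod_nonneg fun j _ => (studentWeight_pos hτ _).le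
      simp only [truncatedStudent, hl, hlR, if_true]
      have hratio : ∏ j, studentWeight τ ((l - a) j) ≤
          Real.exp (4 * ∑ j, Real.log (1 + τ⁻¹ * |a j|)) * ∏ j, studentWeight τ (l j) := by
        rw [Finset.mul_sum, Real.exp_sum, ← Finset.prod_mul_distrib]
        refine Finset.prod_le_prod (fun j _ => (studentWeight_pos hτ _).le) fun j _ => ?_
        have hpos : 0 < 1 + τ⁻¹ * |a j| := by positivity
        have : Real.exp (4 * Real.log (1 + τ⁻¹ * |a j|)) = (1 + τ⁻¹ * |a j|) ^ 4 := by
          rw [show (4 : ℝ) = ((4 : ℕ) : ℝ) by norm_num, Real.exp_nat_mul, Real.exp_log hpos]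
        rw [this]
        exact studentWeight_sub_le hτ _ _
      have hAc : A⁻¹ ≤ Real.exp 1 * c := by
        rw [inv_le_iff_one_le_mul₀ hApos]
        have h2 : (2 : ℝ) ≤ Real.exp 1 := by linarith [Real.add_one_le_exp 1]
        have h3 : c * Z ≤ c * (2 * A) := mul_le_mul_of_nonneg_left hZA hc.le
        have h4 : 2 * (c * A) ≤ Real.exp 1 * (c * A) :=
          mul_le_mul_of_nonneg_right h2 (by positivity)
        linarith
      calc A⁻¹ * ∏ j, studentWeight τ ((l - a) j)
          ≤ (Real.exp 1 * c) * (Real.exp (4 * ∑ j, Real.log (1 + τ⁻¹ * |a j|)) *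
              ∏ j, studentWeight τ (l j)) := by
            refine mul_le_mul hAc hratio ?_ (by positivity)
            exact Finset.prod_nonneg fun j _ => (studentWeight_pos hτ _).le
        _ = _ := by rw [Real.exp_add]; ring
    · have : truncatedStudent τ r (l - a) = 0 := if_neg hl
      rw [this, mul_zero]
      exact mul_nonneg (Real.exp_pos _).le (mul_nonneg hc.le (truncatedStudent_nonneg hτ R l))
  · intro j
    have h := integral_sq_mul_truncatedStudent_le hτ hM j
    rw [inv_mul_le_iff₀ hApos]
    nlinarith [mul_nonneg hApos.le (sq_nonneg τ)]
  · intro y g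
    obtain ⟨hint, hval⟩ :=
      integral_sq_sub_sum_mul_truncatedStudent hτ r (y - ∑ j, a j * g j) g
    have hshift : ∀ l : Fin M → ℝ,
        (A⁻¹ * truncatedStudent τ r (l - a)) • (y - ∑ j, l j * g j) ^ 2 =
        A⁻¹ * (fun u : Fin M → ℝ => (y - ∑ j, a j * g j - ∑ j, u j * g j) ^ 2 *
          truncatedStudent τ r u) (l - a) := by
      intro l
      have : ∑ j, (l - a) j * g j = ∑ j, l j * g j - ∑ j, a j * g j := by
        rw [← Finset.sum_sub_distrib]
        exact Finset.sum_congr rfl fun j _ => by rw [Pi.sub_apply]; ring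
      simp only [this, smul_eq_mul]
      ring
    constructor
    · rw [hp, integrable_withDensity_iff_integrable_smul₀' hmeas.ennreal_ofReal.aemeasurable
        (.of_forall fun l => ENNReal.ofReal_lt_top)]
      simp only [ENNReal.toReal_ofReal (hnonneg _), hshift]
      exact (hint.comp_sub_right a).const_mul _
    · rw [hp, integral_withDensity_eq_integral_toReal_smul₀ hmeas.ennreal_ofReal.aemeasurable
        (.of_forall fun l => ENNReal.ofReal_lt_top)]
      simp only [ENNReal.toReal_ofReal (hnonneg _), hshift]
      rw [integral_const_mul, integral_sub_right_eq_self (fun u : Fin M → ℝ =>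
        (y - ∑ j, a j * g j - ∑ j, u j * g j) ^ 2 * truncatedStudent τ r u) a, hval, mul_add,
        ← hA, mul_left_comm, inv_mul_cancel₀ hApos.ne', mul_one, Finset.mul_sum]
      simp only [mul_assoc]

end SparsityPrior

section Average

/-- Jensen's inequality for the squared risk of a uniform average of estimators. -/
theorem integral_sq_average_sub_le {Ω X : Type*} [MeasurableSpace Ω] [MeasurableSpace X]
    {μ : Measure Ω} {ν : Measure X} {f : X → ℝ} {g : ℕ → Ω → X → ℝ} (n : ℕ)
    (hgx : ∀ m ω, Integrable (fun x => (g m ω x - f x) ^ 2) ν)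
    (hgω : ∀ m, Integrable (fun ω => ∫ x, (g m ω x - f x) ^ 2 ∂ν) μ) :
    ∫ ω, ∫ x, (((n : ℝ) + 1)⁻¹ * ∑ m ∈ Finset.range (n + 1), g m ω x - f x) ^ 2 ∂ν ∂μ ≤
      ((n : ℝ) + 1)⁻¹ * ∑ m ∈ Finset.range (n + 1), ∫ ω, ∫ x, (g m ω x - f x) ^ 2 ∂ν ∂μ := by
  have hn : (0 : ℝ) < n + 1 := by positivity
  have hpt : ∀ ω x, (((n : ℝ) + 1)⁻¹ * ∑ m ∈ Finset.range (n + 1), g m ω x - f x) ^ 2 ≤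
      ((n : ℝ) + 1)⁻¹ * ∑ m ∈ Finset.range (n + 1), (g m ω x - f x) ^ 2 := by
    intro ω x
    have h1 : ((n : ℝ) + 1)⁻¹ * ∑ m ∈ Finset.range (n + 1), g m ω x - f x =
        ((n : ℝ) + 1)⁻¹ * ∑ m ∈ Finset.range (n + 1), (g m ω x - f x) := by
      rw [Finset.sum_sub_distrib, Finset.sum_const, Finset.card_range, nsmul_eq_mul]
      push_cast
      field_simp
    have h2 := sq_sum_le_card_mul_sum_sq (s := Finset.range (n + 1)) (f := fun m => g m ω x - f x)
    rw [Finset.card_range] at h2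
    push_cast at h2
    rw [h1, mul_pow, sq (((n : ℝ) + 1)⁻¹), mul_assoc, inv_mul_le_iff₀ hn, inv_mul_le_iff₀ hn,
      mul_inv_cancel_left₀ hn.ne']
    exact h2
  have hx : ∀ ω, ∫ x, (((n : ℝ) + 1)⁻¹ * ∑ m ∈ Finset.range (n + 1), g m ω x - f x) ^ 2 ∂ν ≤
      ((n : ℝ) + 1)⁻¹ * ∑ m ∈ Finset.range (n + 1), ∫ x, (g m ω x - f x) ^ 2 ∂ν := by
    intro ω
    refine (integral_mono_of_nonneg (.of_forall fun x => sq_nonneg _)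
      ((integrable_finsetSum _ fun m _ => hgx m ω).const_mul _) (.of_forall (hpt ω))).trans_eq ?_
    rw [integral_const_mul, integral_finsetSum _ fun m _ => hgx m ω]
  refine (integral_mono_of_nonneg (.of_forall fun ω => integral_nonneg fun x => sq_nonneg _)
    ((integrable_finsetSum _ fun m _ => hgω m).const_mul _) (.of_forall hx)).trans_eq ?_
  rw [integral_const_mul, integral_finsetSum _ fun m _ => hgω m]

end Average

/-- Proposition 1: In regression with random design, for bounded dictionary
elements and errors with bounded conditional exponential moment, for every
`β ≥ max(2σ² + 2·sup_λ‖f_λ − f‖²_{P_X,∞}, 4RL_φ/b)`, the mirror averaging aggregate with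
the sparsity prior satisfies the sparsity oracle inequality (SOI1). -/
theorem ma_regression_soi
    {X : Type} [MeasurableSpace X]
    (n M : ℕ) (hM : 2 ≤ M)
    (τ R : ℝ) (hτ : 0 < τ) (hR : 2 * M * τ < R)
    -- the data distribution of Z = (X, Y) and the design distribution
    (P : Measure (X × ℝ)) [IsProbabilityMeasure P]
    (PX : Measure X) (hPX : PX = P.map Prod.fst)
    -- the regression function f(x) = E(Y | X = x)
    (f : X → ℝ) (hfmeas : Measurable f)
    (hξ2 : Integrable (fun z : X × ℝ => (z.2 - f z.1) ^ 2) P)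
    (hreg : ∀ A : Set X, MeasurableSet A →
      (∫ z in {z : X × ℝ | z.1 ∈ A}, (z.2 - f z.1) ∂P) = 0)
    -- bounded exponential moment of the noise: E(e^{tξ₁} | X₁) ≤ e^{σ²t²/2}, |t| ≤ b
    (b σ2 : ℝ) (hb : 0 < b) (hσ2 : 0 < σ2)
    (hexpint : ∀ t : ℝ, |t| ≤ b →
      Integrable (fun z : X × ℝ => Real.exp (t * (z.2 - f z.1))) P)
    (hsubg : ∀ t : ℝ, |t| ≤ b → ∀ A : Set X, MeasurableSet A →
      (∫ z in {z : X × ℝ | z.1 ∈ A}, Real.exp (t * (z.2 - f z.1)) ∂P) ≤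
        Real.exp (σ2 * t ^ 2 / 2) * (PX A).toReal)
    -- the normalized dictionary
    (φ : Fin M → X → ℝ) (hφmeas : ∀ j, Measurable (φ j))
    (Lφ : ℝ) (hLφ : 0 < Lφ)
    (hφnorm : ∀ j, (∫ x, φ j x ^ 2 ∂PX) = 1)
    (hφbound : ∀ j, ∀ᵐ x ∂PX, |φ j x| ≤ Lφ)
    (flam : (Fin M → ℝ) → X → ℝ)
    (hflam : ∀ (l : Fin M → ℝ) (x : X), flam l x = ∑ j, l j * φ j x)
    -- D bounds sup_{‖λ‖₁ ≤ R} ‖f_λ − f‖²_{P_X,∞}, and β is large enough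
    (D : ℝ)
    (hD : ∀ l : Fin M → ℝ, (∑ j, |l j|) ≤ R → ∀ᵐ x ∂PX, (flam l x - f x) ^ 2 ≤ D)
    (β : ℝ) (hβ : max (2 * σ2 + 2 * D) (4 * R * Lφ / b) ≤ β)
    -- the sparsity prior (with normalizing constant c)
    (c : ℝ) (hc : 0 < c)
    (π : Measure (Fin M → ℝ))
    (hπ : π = volume.withDensity fun l => ENNReal.ofReal
      (if (∑ j, |l j|) ≤ R then c * ∏ j, ((τ ^ 2 + l j ^ 2) ^ 2)⁻¹ else 0))
    (hπprob : IsProbabilityMeasure π)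
    -- the mirror averaging aggregate with Q(z,g) = (y − g(x))²
    (θ : ℕ → (Fin n → X × ℝ) → (Fin M → ℝ) → ℝ)
    (hθ : ∀ (m : ℕ) (z : Fin n → X × ℝ) (l : Fin M → ℝ), θ m z l =
      Real.exp (-(∑ i ∈ Finset.univ.filter (fun i : Fin n => (i : ℕ) < m),
          ((z i).2 - flam l (z i).1) ^ 2) / β) /
        ∫ w, Real.exp (-(∑ i ∈ Finset.univ.filter (fun i : Fin n => (i : ℕ) < m),
          ((z i).2 - flam w (z i).1) ^ 2) / β) ∂π)
    (fhat : (Fin n → X × ℝ) → X → ℝ)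
    (hfhat : ∀ (z : Fin n → X × ℝ) (x : X), fhat z x =
      ((n : ℝ) + 1)⁻¹ * ∑ m ∈ Finset.range (n + 1), ∫ l, θ m z l * flam l x ∂π) :
    ∀ lstar : Fin M → ℝ, (∑ j, |lstar j|) ≤ R - 2 * M * τ →
      (∫ z, ∫ x, (fhat z x - f x) ^ 2 ∂PX ∂(Measure.pi fun _ : Fin n => P)) ≤
        (∫ x, (flam lstar x - f x) ^ 2 ∂PX) +
          (4 * β / (n + 1)) * (∑ j, Real.log (1 + τ⁻¹ * |lstar j|)) +
          (4 * τ ^ 2 * M + β / (n + 1)) := by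

  intro lstar hlstar
  obtain rfl : flam = fun l x => ∑ j, l j * φ j x := funext fun l => funext fun x => hflam l x
  have hPXfst : PX = P.fst := hPX
  subst hPXfst
  clear hPX hflam
  set F : (Fin M → ℝ) → X → ℝ := fun l x => ∑ j, l j * φ j x with hFdef
  have hF : Measurable (Function.uncurry F) :=
    Finset.measurable_sum _ fun j _ =>
      ((measurable_pi_apply j).comp measurable_fst).mul ((hφmeas j).comp measurable_snd)
  have hM0 : 0 < M := by omega
  have hR0 : 0 < R := lt_of_le_of_lt (by positivity) hR
  have hβ1 : 2 * σ2 + 2 * D ≤ β := (le_max_left _ _).trans hβ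
  have hβ2 : 4 * R * Lφ / b ≤ β := (le_max_right _ _).trans hβ
  have hβ0 : 0 < β := lt_of_lt_of_le (by positivity) hβ2
  have hβb : 4 * (R * Lφ) ≤ b * β := by
    rw [div_le_iff₀ hb] at hβ2
    linarith
  have hD0 : 0 ≤ D := by
    obtain ⟨x, hx⟩ := (hD 0 (by simpa using hR0.le)).exists
    exact (sq_nonneg _).trans hx
  have hπ' : π = volume.withDensity fun l => ENNReal.ofReal (c * truncatedStudent τ R l) := by
    rw [hπ]
    congr 1
    ext l
    simp only [truncatedStudent, studentWeight, mul_ite, mul_zero]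
  have hball : ∀ᵐ l ∂π, ∑ j, |l j| ≤ R := by
    rw [hπ', ae_withDensity_iff ((measurable_truncatedStudent R).const_mul c).ennreal_ofReal]
    refine .of_forall fun l hl => ?_
    by_contra h
    simp [truncatedStudent, h] at hl
  have hFB : ∀ᵐ x ∂P.fst, ∀ᵐ l ∂π, |F l x| ≤ R * Lφ ∧ (F l x - f x) ^ 2 ≤ D := by
    have hswap : ∀ᵐ x ∂P.fst, ∀ᵐ l ∂π, (F l x - f x) ^ 2 ≤ D := by
      refine (Measure.ae_ae_comm (p := fun l x => (F l x - f x) ^ 2 ≤ D) ?_).1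
        (hball.mono fun l hl => hD l hl)
      exact measurableSet_le ((hF.sub (hfmeas.comp measurable_snd)).pow_const 2) measurable_const
    filter_upwards [hswap, ae_all_iff.2 hφbound] with x hx1 hx2
    filter_upwards [hx1, hball] with l hl1 hl2
    refine ⟨?_, hl1⟩
    calc |F l x| ≤ ∑ j, |l j * φ j x| := Finset.abs_sum_le_sum_abs _ _
      _ ≤ ∑ j, |l j| * Lφ := Finset.sum_le_sum fun j _ => by
          rw [abs_mul]; exact mul_le_mul_of_nonneg_left (hx2 j) (abs_nonneg _)
      _ ≤ R * Lφ := by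
          rw [← Finset.sum_mul]; exact mul_le_mul_of_nonneg_right hl2 hLφ.le
  obtain ⟨p, v, hpprob, hp, hv, hpF⟩ := exists_translated_prior hM0 hτ hc hπ' hlstar
  have hFstar : Measurable (F lstar) := hF.comp (measurable_const.prodMk measurable_id)
  have hlstarR : ∑ j, |lstar j| ≤ R := hlstar.trans (sub_le_self _ (by positivity))
  obtain ⟨hstarint, hstar⟩ := integral_sq_sub_eq_add hfmeas hξ2 hreg hFstar (hD lstar hlstarR)
  have hφint : ∀ j, Integrable (fun x => φ j x ^ 2) P.fst := by
    intro j
    refine Integrable.of_bound ((hφmeas j).pow_const 2).aestronglyMeasurable (Lφ ^ 2) ?_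
    filter_upwards [hφbound j] with x hx
    rw [norm_pow]
    exact pow_le_pow_left₀ (norm_nonneg _) hx 2
  have hφint' : ∀ j, Integrable (fun z : X × ℝ => v j * φ j z.1 ^ 2) P := fun j =>
    (Integrable.comp_measurable (g := fun x => φ j x ^ 2) (hφint j) measurable_fst).const_mul _
  have hφnorm' : ∀ j, ∫ z : X × ℝ, φ j z.1 ^ 2 ∂P = 1 := by
    intro j
    rw [← hφnorm j, Measure.fst, integral_map measurable_fst.aemeasurable
      ((hφmeas j).pow_const 2).aestronglyMeasurable]
  have hpz : ∀ z : X × ℝ, ∫ l, (z.2 - F l z.1) ^ 2 ∂p =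
      (z.2 - F lstar z.1) ^ 2 + ∑ j, v j * φ j z.1 ^ 2 := fun z => (hpF z.2 fun j => φ j z.1).2
  have hsumint : Integrable (fun z : X × ℝ => ∑ j, v j * φ j z.1 ^ 2) P :=
    integrable_finsetSum _ fun j _ => hφint' j
  have hpP : Integrable (fun z : X × ℝ => ∫ l, (z.2 - F l z.1) ^ 2 ∂p) P := by
    simp only [hpz]
    exact hstarint.add hsumint
  have hmain := sum_integral_sq_tilted_le hfmeas hξ2 hreg
    (ae_lintegral_exp_condKernel_le hfmeas hb hexpint hsubg) hF hFB hσ2.le hD0 hβ0 hβ1 hβb hp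
    (fun z => (hpF z.2 fun j => φ j z.1).1) hpP n
  have hprior : ∫ z, ∫ l, (z.2 - F l z.1) ^ 2 ∂p ∂P - ∫ z, (z.2 - f z.1) ^ 2 ∂P ≤
      ∫ x, (F lstar x - f x) ^ 2 ∂P.fst + 4 * τ ^ 2 * M := by
    simp only [hpz]
    rw [integral_add hstarint hsumint, hstar, integral_finsetSum _ fun j _ => hφint' j]
    simp only [integral_const_mul, hφnorm', mul_one]
    have : ∑ j, v j ≤ ∑ _j : Fin M, 4 * τ ^ 2 := Finset.sum_le_sum fun j _ => hv j
    rw [Finset.sum_const, Finset.card_univ, Fintype.card_fin, nsmul_eq_mul] at this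
    linarith
  have hfhat' : ∀ z x, fhat z x = ((n : ℝ) + 1)⁻¹ * ∑ m ∈ Finset.range (n + 1),
      ∫ l, F l x ∂π.tilted (fun l => -cumLoss F m z l / β) := by
    intro z x
    rw [hfhat]
    congr 1
    refine Finset.sum_congr rfl fun m _ => ?_
    rw [integral_tilted]
    simp only [hθ, smul_eq_mul, cumLoss, hFdef]
  have havg := integral_sq_average_sub_le (μ := Measure.pi fun _ : Fin n => P) (ν := P.fst) (f := f)
    (g := fun m z x => ∫ l, F l x ∂π.tilted (fun l => -cumLoss F m z l / β)) n
    (fun m z => by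
      have hmeas : Measurable fun x => ∫ l, F l x ∂π.tilted (fun l => -cumLoss F m z l / β) :=
        (measurable_integral_tilted_cumLoss (π := π) (β := β) hF n m).comp
          (f := fun x => (z, x)) (measurable_const.prodMk measurable_id)
      refine Integrable.of_bound (by fun_prop) D ?_
      filter_upwards [sq_integral_tilted_cumLoss_sub_le hF hFB hD0 hβ0 m z] with x hx
      rwa [Real.norm_of_nonneg (sq_nonneg _)])
    (fun m => integrable_integral_sq_tilted hfmeas hF hFB hD0 hβ0 n m)
  simp only [hfhat']
  have hn : (0 : ℝ) < n + 1 := by positivity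
  refine havg.trans ?_
  rw [inv_mul_le_iff₀ hn]
  refine hmain.trans ?_
  have h := mul_le_mul_of_nonneg_left hprior hn.le
  refine (add_le_add_right h _).trans_eq ?_
  field_simp
  ring
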